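/- Assume the Riemann hypothesis. For an integer k ≥ 2 let g_k be the multiplicative function with g_k(p^j) = 1 for all primes p and 1 ≤ j ≤ k−1, g_k(p^j) = −1 for k ≤ j ≤ 2k−1, and g_k(p^j) = 0 for j ≥ 2k (and g_k(1) = 1). Then for every ε > 0 one has Σ_{n≤x} g_k(n) − x/ζ(k)² ≪_{k,ε} x^{1/(k+1)+ε}, where ζ(k) = Σ_{n≥1} n^{−k}. -/

import Mathlib

open Filter

/-- The tent-like weight `max 0 (1 - v)`. -/
noncomputable def rieszKernel (v : ℝ) : ℝ := max 0 (1 - v)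

theorem continuous_rieszKernel : Continuous rieszKernel := by
  unfold rieszKernel; fun_prop

theorem hasMellin_rieszKernel {s : ℂ} (hs : 0 < s.re) :
    HasMellin (fun v : ℝ => (rieszKernel v : ℂ)) s (1 / (s * (s + 1))) := by
  have h1 := hasMellin_one_Ioc hs
  have h2 := hasMellin_cpow_Ioc (1 : ℂ) (s := s) (by simp; linarith)
  have h3 := hasMellin_sub h1.1 h2.1
  have hs0 : s ≠ 0 := by rintro rfl; simp at hs
  have hs1 : s + 1 ≠ 0 := by
    intro h; have := congrArg Complex.re h; simp at this; linarith
  have e : ∀ t ∈ Set.Ioi (0:ℝ), (Set.indicator (Set.Ioc 0 1) (fun _ => 1 : ℝ → ℂ) t -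
      Set.indicator (Set.Ioc 0 1) (fun t : ℝ => (t : ℂ) ^ (1 : ℂ)) t) = (rieszKernel t : ℂ) := by
    intro t (ht : 0 < t)
    unfold rieszKernel
    by_cases h : t ≤ 1
    · have hm : t ∈ Set.Ioc (0 : ℝ) 1 := ⟨ht, h⟩
      rw [Set.indicator_of_mem hm, Set.indicator_of_mem hm, max_eq_right (by linarith)]
      simp
    · rw [Set.indicator_of_notMem (by simp [h]), Set.indicator_of_notMem (by simp [h]),
        max_eq_left (by linarith)]
      simp
  constructor
  · refine (h3.1).congr_fun (fun t ht => ?_) measurableSet_Ioi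
    simp only
    rw [e t ht]
  · have : mellin (fun v : ℝ => (rieszKernel v : ℂ)) s = _ :=
      (MeasureTheory.setIntegral_congr_fun measurableSet_Ioi
      (fun t ht => by simp only; rw [e t ht])).symm.trans h3.2
    rw [this, h1.2, h2.2]
    field_simp
    ring

theorem sq_le_norm_mul_add_one (c τ : ℝ) (hc : 0 < c) :
    (c ^ 2 + τ ^ 2) ≤ ‖((c : ℂ) + τ * Complex.I) * ((c : ℂ) + τ * Complex.I + 1)‖ := by
  have h1 : ‖(c : ℂ) + τ * Complex.I‖ ^ 2 = c ^ 2 + τ ^ 2 := by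
    rw [← Complex.normSq_eq_norm_sq, Complex.normSq_add_mul_I]
  have h2 : ‖(c : ℂ) + τ * Complex.I + 1‖ ^ 2 = (c + 1) ^ 2 + τ ^ 2 := by
    rw [← Complex.normSq_add_mul_I, Complex.normSq_eq_norm_sq]; push_cast; ring_nf
  rw [norm_mul, ← h1, sq]
  gcongr
  rw [← sq_le_sq₀ (norm_nonneg _) (norm_nonneg _), h1, h2]
  nlinarith

/-- Polynomial decay on a vertical line forces integrability. -/
theorem integrable_of_le_one_add_abs_rpow {f : ℝ → ℂ} (hf : Continuous f) {C r : ℝ} (hr : 1 < r)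
    (h : ∀ τ, ‖f τ‖ ≤ C * (1 + |τ|) ^ (-r)) : MeasureTheory.Integrable f := by
  have := (integrable_one_add_norm (E := ℝ) (μ := MeasureTheory.volume) (r := r)
    (by simpa using hr)).const_mul C
  exact this.mono' hf.aestronglyMeasurable (Eventually.of_forall fun τ => by
    simpa [Real.norm_eq_abs] using h τ)

theorem one_add_abs_sq_le {c : ℝ} (hc : 0 < c) (τ : ℝ) :
    (1 + |τ|) ^ 2 ≤ 2 * (1 + 1 / c ^ 2) * (c ^ 2 + τ ^ 2) := by
  have h1 : (1 + |τ|) ^ 2 ≤ 2 * (1 + τ ^ 2) := by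
    have := sq_abs τ; nlinarith [sq_nonneg (1 - |τ|)]
  have h2 : 2 * (1 + 1 / c ^ 2) * (c ^ 2 + τ ^ 2) =
      2 * (1 + τ ^ 2) + 2 * (c ^ 2 + τ ^ 2 / c ^ 2) := by field_simp; ring
  have : 0 ≤ 2 * (c ^ 2 + τ ^ 2 / c ^ 2) := by positivity
  linarith

theorem norm_inv_mul_add_one_le {c : ℝ} (hc : 0 < c) (τ : ℝ) :
    ‖1 / (((c : ℂ) + τ * Complex.I) * ((c : ℂ) + τ * Complex.I + 1))‖ ≤
      2 * (1 + 1 / c ^ 2) * (1 + |τ|) ^ (-2 : ℝ) := by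
  rw [norm_div, norm_one, Real.rpow_neg (by positivity), ← div_eq_mul_inv,
    div_le_div_iff₀ (lt_of_lt_of_le (by positivity) (sq_le_norm_mul_add_one c τ hc)) (by positivity)]
  rw [one_mul, Real.rpow_two]
  refine (one_add_abs_sq_le hc τ).trans ?_
  gcongr
  exact sq_le_norm_mul_add_one c τ hc

theorem verticalLine_ne_zero {c : ℝ} (hc : 0 < c) (τ : ℝ) : (c : ℂ) + τ * Complex.I ≠ 0 := by
  intro h; have := congrArg Complex.re h; simp at this; linarith

theorem verticalLine_add_one_ne_zero {c : ℝ} (hc : 0 < c) (τ : ℝ) :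
    (c : ℂ) + τ * Complex.I + 1 ≠ 0 := by
  intro h; have := congrArg Complex.re h; simp at this; linarith

theorem rieszKernel_eq_integral {c v : ℝ} (hc : 0 < c) (hv : 0 < v) :
    (rieszKernel v : ℂ) = (1 / (2 * Real.pi) : ℝ) * ∫ τ : ℝ,
      (v : ℂ) ^ (-((c : ℂ) + τ * Complex.I)) *
        (1 / (((c : ℂ) + τ * Complex.I) * ((c : ℂ) + τ * Complex.I + 1))) := by
  have hm : ∀ τ : ℝ, mellin (fun v : ℝ => (rieszKernel v : ℂ)) ((c : ℂ) + τ * Complex.I) =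
      1 / (((c : ℂ) + τ * Complex.I) * ((c : ℂ) + τ * Complex.I + 1)) :=
    fun τ => (hasMellin_rieszKernel (by simpa using hc)).2
  have h := mellinInv_mellin_eq c (fun v : ℝ => (rieszKernel v : ℂ)) hv
    (hasMellin_rieszKernel (by simpa using hc)).1 ?_
    (Complex.continuous_ofReal.comp continuous_rieszKernel).continuousAt
  · rw [← h, mellinInv]
    simp_rw [hm, smul_eq_mul]
    simp
  · unfold Complex.VerticalIntegrable
    simp_rw [hm]
    refine integrable_of_le_one_add_abs_rpow ?_ (r := 2) (by norm_num) (norm_inv_mul_add_one_le hc)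
    refine continuous_const.div (by fun_prop) fun τ =>
      mul_ne_zero (verticalLine_ne_zero hc τ) (verticalLine_add_one_ne_zero hc τ)

theorem HasMellin.comp_inv {f : ℝ → ℂ} {s m : ℂ} (h : HasMellin f s m) :
    HasMellin (fun t => f t⁻¹) (-s) m := by
  refine ⟨?_, by rw [mellin_comp_inv, neg_neg, h.2]⟩
  have := (MellinConvergent.comp_rpow (f := f) (s := -s) (a := -1) (by norm_num)).2
    (by simpa using h.1)
  refine this.congr_fun (fun t ht => ?_) measurableSet_Ioi
  simp [Real.rpow_neg_one]

theorem HasMellin.congr {f g : ℝ → ℂ} {s m : ℂ} (h : HasMellin f s m)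
    (hfg : ∀ t, 0 < t → f t = g t) : HasMellin g s m := by
  refine ⟨h.1.congr_fun (fun t ht => ?_) measurableSet_Ioi, ?_⟩
  · simp only [hfg t ht]
  · rw [← h.2]
    exact MeasureTheory.setIntegral_congr_fun measurableSet_Ioi
      (fun t ht => by simp only [hfg t ht])

theorem HasMellin.add {f g : ℝ → ℂ} {s m m' : ℂ} (h : HasMellin f s m) (h' : HasMellin g s m') :
    HasMellin (fun t => f t + g t) s (m + m') := by
  have := hasMellin_add h.1 h'.1
  rwa [h.2, h'.2] at this

theorem HasMellin.const_mul {f : ℝ → ℂ} {s m : ℂ} (h : HasMellin f s m) (c : ℂ) :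
    HasMellin (fun t => c * f t) s (c * m) := by
  have := hasMellin_const_smul h.1 c
  rwa [h.2] at this

theorem hasMellin_cpow_Ioi (a : ℂ) {s : ℂ} (hs : s.re + a.re < 0) :
    HasMellin (Set.indicator (Set.Ioi 1) (fun t => (t : ℂ) ^ a : ℝ → ℂ)) s (-1 / (s + a)) := by
  have hre : (s - 1 + a).re < -1 := by simp; linarith
  have key : ∀ t ∈ Set.Ioi (0 : ℝ),
      Set.indicator (Set.Ioi 1) (fun t : ℝ => (t : ℂ) ^ (s - 1 + a)) t =
      (t : ℂ) ^ (s - 1) • Set.indicator (Set.Ioi 1) (fun t : ℝ => (t : ℂ) ^ a) t := by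
    intro t (ht : 0 < t)
    by_cases h : t ∈ Set.Ioi (1 : ℝ)
    · rw [Set.indicator_of_mem h, Set.indicator_of_mem h, smul_eq_mul,
        Complex.cpow_add _ _ (by exact_mod_cast ht.ne')]
    · rw [Set.indicator_of_notMem h, Set.indicator_of_notMem h, smul_zero]
  have hInt := integrableOn_Ioi_cpow_of_lt hre one_pos
  constructor
  · refine MeasureTheory.IntegrableOn.congr_fun ?_ key measurableSet_Ioi
    exact (hInt.integrable_indicator measurableSet_Ioi).integrableOn
  · rw [mellin, ← MeasureTheory.setIntegral_congr_fun measurableSet_Ioi key,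
      MeasureTheory.setIntegral_indicator measurableSet_Ioi,
      Set.inter_eq_right.2 (Set.Ioi_subset_Ioi zero_le_one), integral_Ioi_cpow_of_lt hre one_pos]
    simp
    ring_nf

/-- `{t} - {t}²`, a continuous periodic function. -/
noncomputable def fractBump (t : ℝ) : ℝ := Int.fract t - Int.fract t ^ 2

theorem fractBump_nonneg (t : ℝ) : 0 ≤ fractBump t := by
  unfold fractBump; nlinarith [Int.fract_nonneg t, Int.fract_lt_one t]

theorem fractBump_le (t : ℝ) : fractBump t ≤ 1 / 4 := by
  unfold fractBump; nlinarith [sq_nonneg (Int.fract t - 1 / 2)]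

theorem fractBump_of_lt_one {t : ℝ} (h0 : 0 ≤ t) (h1 : t < 1) : fractBump t = t - t ^ 2 := by
  unfold fractBump; rw [Int.fract_eq_self.2 ⟨h0, h1⟩]

theorem fractBump_one : fractBump 1 = 0 := by simp [fractBump]

theorem measurable_fractBump : Measurable fractBump := by
  unfold fractBump; fun_prop

theorem continuous_fractBump : Continuous fractBump := by
  have : Continuous ((fun x : ℝ => x - x ^ 2) ∘ Int.fract) :=
    ContinuousOn.comp_fract'' (by fun_prop) (by norm_num)
  exact this

/-- Half of `fractBump`, cut off to `(1, ∞)`. -/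
noncomputable def fractTail (t : ℝ) : ℂ :=
  Set.indicator (Set.Ioi (1 : ℝ)) (fun t => ((fractBump t / 2 : ℝ) : ℂ)) t

theorem norm_fractTail_le (t : ℝ) :
    ‖fractTail t‖ ≤ Set.indicator (Set.Ioi (1 : ℝ)) (fun _ => 1 / 8) t := by
  unfold fractTail
  by_cases h : t ∈ Set.Ioi (1 : ℝ)
  · rw [Set.indicator_of_mem h, Set.indicator_of_mem h, Complex.norm_real, Real.norm_eq_abs,
      abs_of_nonneg (by have := fractBump_nonneg t; positivity)]
    linarith [fractBump_le t]
  · simp [Set.indicator_of_notMem h]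

theorem measurable_fractTail : Measurable fractTail := by
  unfold fractTail
  exact (Complex.measurable_ofReal.comp (measurable_fractBump.div_const 2)).indicator
    measurableSet_Ioi

theorem locallyIntegrableOn_fractTail :
    MeasureTheory.LocallyIntegrableOn fractTail (Set.Ioi 0) := by
  refine MeasureTheory.LocallyIntegrable.locallyIntegrableOn ?_ _
  refine (MeasureTheory.locallyIntegrable_const (1 / 8 : ℝ)).mono
    measurable_fractTail.aestronglyMeasurable (Eventually.of_forall fun t => ?_)
  refine (norm_fractTail_le t).trans ?_
  by_cases h : t ∈ Set.Ioi (1 : ℝ)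
  · rw [Set.indicator_of_mem h]; exact le_abs_self _
  · rw [Set.indicator_of_notMem h]; positivity

theorem fractTail_isBigO_top : fractTail =O[atTop] fun x : ℝ => x ^ (-(0 : ℝ)) := by
  refine Asymptotics.IsBigO.of_bound (1 / 8) (Eventually.of_forall fun t => ?_)
  refine (norm_fractTail_le t).trans ?_
  by_cases h : t ∈ Set.Ioi (1 : ℝ)
  · rw [Set.indicator_of_mem h]; simp
  · rw [Set.indicator_of_notMem h]; positivity

theorem fractTail_isBigO_zero (b : ℝ) :
    fractTail =O[nhdsWithin 0 (Set.Ioi 0)] fun x : ℝ => x ^ (-b) := by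
  refine Asymptotics.IsBigO.of_bound 1 ?_
  filter_upwards [mem_nhdsWithin_of_mem_nhds (Iio_mem_nhds one_pos)] with t ht
  refine (norm_fractTail_le t).trans ?_
  rw [Set.indicator_of_notMem (by simpa using le_of_lt ht)]
  positivity

theorem mellinConvergent_fractTail {s : ℂ} (hs : s.re < 0) : MellinConvergent fractTail s :=
  mellinConvergent_of_isBigO_rpow locallyIntegrableOn_fractTail fractTail_isBigO_top hs
    (fractTail_isBigO_zero (s.re - 1)) (by linarith)

theorem differentiableAt_mellin_fractTail {s : ℂ} (hs : s.re < 0) :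
    DifferentiableAt ℂ (mellin fractTail) s :=
  mellin_differentiableAt_of_isBigO_rpow locallyIntegrableOn_fractTail fractTail_isBigO_top hs
    (fractTail_isBigO_zero (s.re - 1)) (by linarith)

theorem norm_mellin_fractTail_le {s : ℂ} (hs : s.re ≤ -1) : ‖mellin fractTail s‖ ≤ 1 := by
  have h1 : ‖mellin fractTail s‖ ≤
      ∫ t in Set.Ioi (0 : ℝ), Set.indicator (Set.Ioi (1 : ℝ)) (fun t => t ^ (-2 : ℝ)) t := by
    refine MeasureTheory.norm_integral_le_of_norm_le ?_ ?_
    · exact ((integrableOn_Ioi_rpow_of_lt (by norm_num) one_pos).integrable_indicator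
        measurableSet_Ioi).integrableOn
    · refine (MeasureTheory.ae_restrict_iff' measurableSet_Ioi).2 (Eventually.of_forall ?_)
      intro t (ht : 0 < t)
      rw [norm_smul, Complex.norm_cpow_eq_rpow_re_of_pos ht]
      refine (mul_le_mul_of_nonneg_left (norm_fractTail_le t) (by positivity)).trans ?_
      by_cases h : t ∈ Set.Ioi (1 : ℝ)
      · rw [Set.indicator_of_mem h, Set.indicator_of_mem h]
        have : t ^ (s - 1).re ≤ t ^ (-2 : ℝ) :=
          Real.rpow_le_rpow_of_exponent_le (le_of_lt h) (by simp; linarith)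
        have h0 : 0 ≤ t ^ (s - 1).re := by positivity
        linarith
      · rw [Set.indicator_of_notMem h, Set.indicator_of_notMem h, mul_zero]
  refine h1.trans_eq ?_
  rw [MeasureTheory.setIntegral_indicator measurableSet_Ioi,
      Set.inter_eq_right.2 (Set.Ioi_subset_Ioi zero_le_one),
      integral_Ioi_rpow_of_lt (by norm_num) one_pos]
  norm_num

/-- `R(t) / t` where `R(t) = ∑_{n ≤ t} (t - n)`, in closed form. -/
noncomputable def rampSum (t : ℝ) : ℝ := (t - 1 + fractBump t / t) / 2

theorem tsum_rieszKernel {t : ℝ} (ht : 0 < t) :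
    ∑' n : ℕ, rieszKernel ((n + 1 : ℝ) * t⁻¹) = rampSum t := by
  rw [tsum_eq_sum (s := Finset.range ⌊t⌋₊)]
  · have : ∀ n ∈ Finset.range ⌊t⌋₊, rieszKernel ((n + 1 : ℝ) * t⁻¹) = 1 - (n + 1 : ℝ) * t⁻¹ := by
      intro n hn
      have h1 : n + 1 ≤ ⌊t⌋₊ := by simpa using hn
      have h2 : ((n + 1 : ℕ) : ℝ) ≤ t := (Nat.le_floor_iff ht.le).1 h1
      push_cast at h2
      refine max_eq_right ?_
      rw [sub_nonneg, ← div_eq_mul_inv, div_le_one ht]; exact h2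
    rw [Finset.sum_congr rfl this, Finset.sum_sub_distrib, ← Finset.sum_mul]
    have gauss : ∀ N : ℕ, ∑ n ∈ Finset.range N, (n + 1 : ℝ) = N * (N + 1) / 2 := by
      intro N
      induction N with
      | zero => simp
      | succ N ih => rw [Finset.sum_range_succ, ih]; push_cast; ring
    rw [gauss]
    have hf : Int.fract t = t - ⌊t⌋₊ := by
      rw [← Int.self_sub_floor, natCast_floor_eq_intCast_floor ht.le]
    unfold rampSum fractBump
    rw [hf]
    simp
    field_simp
    ring
  · intro n hn
    have h1 : ⌊t⌋₊ < n + 1 := by simp at hn; omega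
    have h2 : t < ((n + 1 : ℕ) : ℝ) := (Nat.floor_lt ht.le).1 h1
    push_cast at h2
    refine max_eq_left ?_
    rw [sub_nonpos, ← div_eq_mul_inv, le_div_iff₀ ht]; linarith

theorem hasMellin_rieszKernel_scaled {s : ℂ} (hs : 0 < s.re) (n : ℕ) :
    HasMellin (fun t : ℝ => (rieszKernel ((n + 1 : ℝ) * t⁻¹) : ℂ)) (-s)
      (((n + 1 : ℝ) : ℂ) ^ (-s) * (1 / (s * (s + 1)))) := by
  have h := hasMellin_rieszKernel hs
  have hn : (0 : ℝ) < n + 1 := by positivity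
  have h2 : HasMellin (fun t : ℝ => (rieszKernel ((n + 1 : ℝ) * t) : ℂ)) s
      (((n + 1 : ℝ) : ℂ) ^ (-s) * (1 / (s * (s + 1)))) := by
    refine ⟨(MellinConvergent.comp_mul_left (f := fun v : ℝ => (rieszKernel v : ℂ)) hn).2 h.1, ?_⟩
    rw [mellin_comp_mul_left (fun v : ℝ => (rieszKernel v : ℂ)) s hn, h.2, smul_eq_mul]
  exact h2.comp_inv

theorem rieszKernel_nonneg (v : ℝ) : 0 ≤ rieszKernel v := le_max_left _ _

theorem mellin_rampSum {s : ℂ} (hs : 1 < s.re) :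
    mellin (fun t => (rampSum t : ℂ)) (-s) = riemannZeta s * (1 / (s * (s + 1))) := by
  have hs0 : 0 < s.re := by linarith
  set F : ℕ → ℝ → ℂ := fun n t => (t : ℂ) ^ (-s - 1) • (rieszKernel ((n + 1 : ℝ) * t⁻¹) : ℂ)
  have hInt : ∀ n, MeasureTheory.Integrable (F n) (MeasureTheory.volume.restrict (Set.Ioi 0)) :=
    fun n => (hasMellin_rieszKernel_scaled hs0 n).1
  have hnorm : ∀ n, ∫ t in Set.Ioi (0 : ℝ), ‖F n t‖ =
      (n + 1 : ℝ) ^ (-s.re) * (1 / (s.re * (s.re + 1))) := by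
    intro n
    have h := (hasMellin_rieszKernel_scaled (s := (s.re : ℂ)) (by simpa using hs0) n).2
    rw [mellin] at h
    have h' : ∫ t in Set.Ioi (0 : ℝ), ((‖F n t‖ : ℝ) : ℂ) =
        (((n + 1 : ℝ) ^ (-s.re) * (1 / (s.re * (s.re + 1))) : ℝ) : ℂ) := by
      have e : (((n + 1 : ℝ) ^ (-s.re) * (1 / (s.re * (s.re + 1))) : ℝ) : ℂ) =
        ((n + 1 : ℝ) : ℂ) ^ (-(s.re : ℂ)) * (1 / ((s.re : ℂ) * ((s.re : ℂ) + 1))) := by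
        rw [Complex.ofReal_mul, Complex.ofReal_cpow (by positivity)]
        push_cast; rfl
      rw [e, ← h]
      refine MeasureTheory.setIntegral_congr_fun measurableSet_Ioi fun t ht => ?_
      have ht : 0 < t := ht
      simp only [F]
      rw [norm_smul, Complex.norm_cpow_eq_rpow_re_of_pos ht, Complex.norm_real, Real.norm_eq_abs,
        abs_of_nonneg (rieszKernel_nonneg _), smul_eq_mul, Complex.ofReal_mul,
        Complex.ofReal_cpow ht.le]
      simp
    rw [integral_complex_ofReal] at h'
    exact_mod_cast h'
  have hsum : Summable fun n : ℕ => ∫ t in Set.Ioi (0 : ℝ), ‖F n t‖ := by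
    simp_rw [hnorm]
    refine Summable.mul_right _ ?_
    have := (summable_nat_add_iff 1).2 (Real.summable_nat_rpow.2 (show -s.re < -1 by linarith))
    simpa using this
  have H := MeasureTheory.hasSum_integral_of_summable_integral_norm hInt hsum
  have e1 : ∀ n, ∫ t in Set.Ioi (0 : ℝ), F n t =
      ((n + 1 : ℝ) : ℂ) ^ (-s) * (1 / (s * (s + 1))) :=
    fun n => (hasMellin_rieszKernel_scaled hs0 n).2
  simp_rw [e1] at H
  have e2 : ∫ t in Set.Ioi (0 : ℝ), ∑' n, F n t = mellin (fun t => (rampSum t : ℂ)) (-s) := by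
    rw [mellin]
    refine MeasureTheory.setIntegral_congr_fun measurableSet_Ioi fun t ht => ?_
    simp only [F]
    rw [tsum_const_smul'', ← tsum_rieszKernel ht, Complex.ofReal_tsum]
  rw [← e2, ← H.tsum_eq, tsum_mul_right, zeta_eq_tsum_one_div_nat_add_one_cpow hs]
  congr 2
  ext n
  rw [Complex.cpow_neg, one_div]
  push_cast
  rfl

theorem hasMellin_fractTail_div {s : ℂ} (hs : 0 < s.re + 1) :
    HasMellin (fun t : ℝ => (t : ℂ) ^ (-1 : ℂ) • fractTail t) (-s) (mellin fractTail (-s - 1)) := by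
  refine ⟨MellinConvergent.cpow_smul.2 (mellinConvergent_fractTail (by simp; linarith)), ?_⟩
  rw [mellin_cpow_smul]; rfl

theorem rampSum_decomp {t : ℝ} (ht : 0 < t) :
    (rampSum t : ℂ) = (1 / 2) * Set.indicator (Set.Ioi 1) (fun t : ℝ => (t : ℂ) ^ (1 : ℂ)) t +
      (-(1 / 2)) * Set.indicator (Set.Ioi 1) (fun t : ℝ => (t : ℂ) ^ (0 : ℂ)) t +
      (t : ℂ) ^ (-1 : ℂ) • fractTail t := by
  unfold fractTail rampSum
  have ht' : (t : ℂ) ≠ 0 := by exact_mod_cast ht.ne'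
  by_cases h : t ∈ Set.Ioi (1 : ℝ)
  · simp only [Set.indicator_of_mem h, Complex.cpow_one, Complex.cpow_zero, Complex.cpow_neg_one]
    push_cast
    simp
    field_simp
    ring
  · simp only [Set.indicator_of_notMem h]
    have h1 : t ≤ 1 := by simpa using h
    rcases h1.lt_or_eq with h1 | rfl
    · rw [fractBump_of_lt_one ht.le h1]
      push_cast
      simp
      field_simp
      ring
    · simp [fractBump_one]

theorem zeta_eq_mellin {s : ℂ} (hs : 1 < s.re) :
    riemannZeta s * (1 / (s * (s + 1))) =
      1 / (2 * (s - 1)) - 1 / (2 * s) + mellin fractTail (-s - 1) := by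
  have hs0 : s ≠ 0 := by rintro rfl; simp at hs; linarith
  have hs1 : s - 1 ≠ 0 := by
    intro h; have := congrArg Complex.re h; simp at this; linarith
  have h := (((hasMellin_cpow_Ioi (1 : ℂ) (s := -s) (by simp; linarith)).const_mul (1 / 2)).add
    ((hasMellin_cpow_Ioi (0 : ℂ) (s := -s) (by simp; linarith)).const_mul (-(1 / 2)))).add
    (hasMellin_fractTail_div (s := s) (by linarith))
  have h2 := (h.congr (g := fun t => (rampSum t : ℂ)) fun t ht => (rampSum_decomp ht).symm).2
  rw [← mellin_rampSum hs, h2]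
  congr 1
  have e : -s + 1 = -(s - 1) := by ring
  rw [e, add_zero]
  field_simp
  ring

/-- `(s - 1) ζ(s)`, with the removable singularity at `1` removed. -/
noncomputable def zetaReg : ℂ → ℂ := Function.update (fun s => (s - 1) * riemannZeta s) 1 1

theorem zetaReg_one : zetaReg 1 = 1 := Function.update_self ..

theorem zetaReg_of_ne {s : ℂ} (hs : s ≠ 1) : zetaReg s = (s - 1) * riemannZeta s :=
  Function.update_of_ne hs ..

theorem differentiable_zetaReg : Differentiable ℂ zetaReg := by
  rw [← differentiableOn_univ,
    ← Complex.differentiableOn_compl_singleton_and_continuousAt_iff (c := 1) Filter.univ_mem]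
  refine ⟨DifferentiableOn.congr (f := fun s ↦ (s - 1) * riemannZeta s)
    (fun s hs ↦ DifferentiableAt.differentiableWithinAt ?_)
    fun s hs ↦ zetaReg_of_ne (Set.mem_sdiff_singleton.mp hs).2, ?_⟩
  · exact (by fun_prop : DifferentiableAt ℂ (fun s : ℂ => s - 1) s).mul
      (differentiableAt_riemannZeta (by simpa using hs))
  · exact continuousAt_update_same.mpr riemannZeta_residue_one

theorem zetaReg_eq {s : ℂ} (hs : 0 < s.re) :
    zetaReg s = (s + 1) / 2 + s * (s + 1) * (s - 1) * mellin fractTail (-s - 1) := by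
  set U : Set ℂ := {s | 0 < s.re}
  have hU : IsOpen U := isOpen_lt continuous_const Complex.continuous_re
  have hconv : Convex ℝ U := convex_halfSpace_re_gt 0
  have hd : DifferentiableOn ℂ (fun s : ℂ => (s + 1) / 2 +
      s * (s + 1) * (s - 1) * mellin fractTail (-s - 1)) U := by
    intro s hs
    have h1 : DifferentiableAt ℂ (mellin fractTail) ((fun s : ℂ => -s - 1) s) :=
      differentiableAt_mellin_fractTail (by
        have : 0 < s.re := hs
        simp; linarith)
    have : DifferentiableAt ℂ (fun s : ℂ => mellin fractTail (-s - 1)) s :=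
      (DifferentiableAt.comp s h1 (by fun_prop) :
        DifferentiableAt ℂ (mellin fractTail ∘ fun s => -s - 1) s)
    exact DifferentiableAt.differentiableWithinAt (by fun_prop)
  refine AnalyticOnNhd.eqOn_of_preconnected_of_eventuallyEq
    (differentiable_zetaReg.differentiableOn.analyticOnNhd hU) (hd.analyticOnNhd hU)
    hconv.isPreconnected (z₀ := 2) (by simp [U]) ?_ hs
  filter_upwards [(isOpen_lt continuous_const Complex.continuous_re).mem_nhds
    (show (1 : ℝ) < (2 : ℂ).re by simp)] with s (hs : 1 < s.re)
  have hs0 : s ≠ 0 := by rintro rfl; simp at hs; linarith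
  have hs1 : s - 1 ≠ 0 := by
    intro h; have := congrArg Complex.re h; simp at this; linarith
  have hs2 : s + 1 ≠ 0 := by
    intro h; have := congrArg Complex.re h; simp at this; linarith
  have h := zeta_eq_mellin hs
  have hz : riemannZeta s = (1 / (2 * (s - 1)) - 1 / (2 * s) + mellin fractTail (-s - 1)) *
      (s * (s + 1)) := by
    rw [← h]; field_simp
  rw [zetaReg_of_ne (sub_ne_zero.1 hs1), hz]
  field_simp
  ring

/-- `⌊u⌋ - u` averaged over `[0, t]`. -/
noncomputable def sawAverage (t : ℝ) : ℝ := (-1 + fractBump t / t) / 2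

theorem hasMellin_sawAverage {s : ℂ} (h0 : 0 < s.re) (h1 : s.re < 1) :
    HasMellin (fun t => (sawAverage t : ℂ)) (-s) (riemannZeta s * (1 / (s * (s + 1)))) := by
  have hs0 : s ≠ 0 := by rintro rfl; simp at h0
  have hs1 : s - 1 ≠ 0 := by
    intro h; have := congrArg Complex.re h; simp at this; linarith
  have hs2 : s + 1 ≠ 0 := by
    intro h; have := congrArg Complex.re h; simp at this; linarith
  have h := (((hasMellin_cpow_Ioc (1 : ℂ) (s := -s) (by simp; linarith)).const_mul (-(1 / 2))).add
    ((hasMellin_cpow_Ioi (0 : ℂ) (s := -s) (by simp; linarith)).const_mul (-(1 / 2)))).add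
    (hasMellin_fractTail_div (s := s) (by linarith))
  have h2 := h.congr (g := fun t => (sawAverage t : ℂ)) fun t ht => ?_
  · convert h2 using 1
    have hz : riemannZeta s = zetaReg s / (s - 1) := by
      rw [zetaReg_of_ne (sub_ne_zero.1 hs1)]; field_simp
    have e : -s + 1 = -(s - 1) := by ring
    rw [hz, zetaReg_eq h0, e, add_zero]
    field_simp
    ring
  · unfold fractTail sawAverage
    have ht' : (t : ℂ) ≠ 0 := by exact_mod_cast ht.ne'
    by_cases h : t ∈ Set.Ioi (1 : ℝ)
    · have h' : t ∉ Set.Ioc (0 : ℝ) 1 := fun hh => absurd hh.2 (not_le.2 h)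
      simp only [Set.indicator_of_mem h, Set.indicator_of_notMem h',
        Complex.cpow_zero, Complex.cpow_neg_one]
      push_cast
      simp
      field_simp
    · simp only [Set.indicator_of_notMem h]
      have h1 : t ≤ 1 := by simpa using h
      rw [Set.indicator_of_mem (show t ∈ Set.Ioc (0 : ℝ) 1 from ⟨ht, h1⟩)]
      rcases h1.lt_or_eq with h1 | rfl
      · rw [fractBump_of_lt_one ht.le h1]
        push_cast
        simp
        field_simp
        ring
      · norm_num [fractBump_one]

theorem zetaReg_ne_zero (hRH : ∀ ρ : ℂ, riemannZeta ρ = 0 → 0 < ρ.re → ρ.re < 1 → ρ.re = 1 / 2)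
    {s : ℂ} (hs : 1 / 2 < s.re) : zetaReg s ≠ 0 := by
  rcases eq_or_ne s 1 with rfl | h1
  · simp [zetaReg_one]
  rw [zetaReg_of_ne h1]
  refine mul_ne_zero (sub_ne_zero.2 h1) fun h => ?_
  rcases lt_or_ge s.re 1 with h2 | h2
  · exact absurd (hRH s h (by linarith) h2) hs.ne'
  · exact riemannZeta_ne_zero_of_one_le_re h2 h

theorem norm_zetaReg_le {s : ℂ} (hs : 0 < s.re) : ‖zetaReg s‖ ≤ 2 * (‖s‖ + 1) ^ 3 := by
  rw [zetaReg_eq hs]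
  have h1 : ‖mellin fractTail (-s - 1)‖ ≤ 1 := norm_mellin_fractTail_le (by simp; linarith)
  have h2 : ‖s + 1‖ ≤ ‖s‖ + 1 := by simpa using norm_add_le s 1
  have h3 : ‖s - 1‖ ≤ ‖s‖ + 1 := by simpa using norm_sub_le s 1
  have h4 : 0 ≤ ‖s‖ := norm_nonneg s
  calc _ ≤ ‖(s + 1) / 2‖ + ‖s * (s + 1) * (s - 1) * mellin fractTail (-s - 1)‖ := norm_add_le _ _
    _ ≤ (‖s‖ + 1) / 2 + (‖s‖ + 1) * (‖s‖ + 1) * (‖s‖ + 1) * 1 := by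
      rw [norm_div, norm_mul, norm_mul, norm_mul, Complex.norm_ofNat]
      gcongr
      linarith
    _ ≤ _ := by nlinarith [mul_nonneg h4 h4, mul_nonneg h4 (mul_nonneg h4 h4)]

theorem norm_LSeries_le_of_re_le_re {f : ℕ → ℂ} {s s' : ℂ} (hf : LSeriesSummable f s)
    (h : s.re ≤ s'.re) : ‖LSeries f s'‖ ≤ ∑' n, ‖LSeries.term f s n‖ :=
  tsum_of_norm_bounded (summable_norm_iff.2 hf).hasSum
    fun n => LSeries.norm_term_le_of_re_le_re f h n

theorem exists_norm_riemannZeta_le {σ : ℝ} (hσ : 1 < σ) :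
    ∃ M : ℝ, 1 ≤ M ∧ ∀ s : ℂ, σ ≤ s.re → ‖riemannZeta s‖ ≤ M ∧ ‖(riemannZeta s)⁻¹‖ ≤ M := by
  have hσ' : 1 < (σ : ℂ).re := by simpa using hσ
  refine ⟨max 1 (max (∑' n, ‖LSeries.term 1 (σ : ℂ) n‖)
    (∑' n, ‖LSeries.term (fun n => (ArithmeticFunction.moebius n : ℂ)) (σ : ℂ) n‖)),
    le_max_left _ _, fun s hs => ?_⟩
  have hs1 : 1 < s.re := by linarith
  constructor
  · rw [← LSeries_one_eq_riemannZeta hs1]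
    refine (norm_LSeries_le_of_re_le_re (LSeriesSummable_one_iff.2 hσ') (by simpa using hs)).trans ?_
    exact (le_max_left _ _).trans (le_max_right _ _)
  · have e : (riemannZeta s)⁻¹ = LSeries (fun n => (ArithmeticFunction.moebius n : ℂ)) s := by
      rw [inv_eq_of_mul_eq_one_right]
      rw [← LSeries_one_eq_riemannZeta hs1]
      exact LSeries_one_mul_Lseries_moebius hs1
    rw [e]
    refine (norm_LSeries_le_of_re_le_re
      (ArithmeticFunction.LSeriesSummable_moebius_iff.2 hσ') (by simpa using hs)).trans ?_
    exact (le_max_right _ _).trans (le_max_right _ _)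

theorem logDeriv_zetaReg_of_one_lt_re {s : ℂ} (hs : 1 < s.re) :
    logDeriv zetaReg s = 1 / (s - 1) + deriv riemannZeta s / riemannZeta s := by
  have h1 : s ≠ 1 := by rintro rfl; simp at hs
  have : zetaReg =ᶠ[nhds s] fun z => (z - 1) * riemannZeta z := by
    filter_upwards [isOpen_ne.mem_nhds h1] with z hz using zetaReg_of_ne hz
  rw [logDeriv_apply, this.deriv_eq, this.eq_of_nhds, ← logDeriv_apply,
    logDeriv_mul (f := fun z => z - 1) s (sub_ne_zero.2 h1)
      (riemannZeta_ne_zero_of_one_le_re hs.le) (by fun_prop) (differentiableAt_riemannZeta h1)]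
  simp [logDeriv_apply]

theorem exists_norm_logDeriv_zetaReg_le :
    ∃ M : ℝ, 1 ≤ M ∧ ∀ s : ℂ, s.re = 2 → ‖logDeriv zetaReg s‖ ≤ M := by
  have h2 : 1 < (2 : ℂ).re := by simp
  refine ⟨1 + ∑' n, ‖LSeries.term (fun n => (ArithmeticFunction.vonMangoldt n : ℂ)) 2 n‖,
    le_add_of_nonneg_right (tsum_nonneg fun n => norm_nonneg _), fun s hs => ?_⟩
  have hs1 : 1 < s.re := by rw [hs]; norm_num
  rw [logDeriv_zetaReg_of_one_lt_re hs1]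
  refine (norm_add_le _ _).trans (add_le_add ?_ ?_)
  · rw [norm_div, norm_one]
    have : 1 ≤ ‖s - 1‖ := by
      refine le_trans ?_ (Complex.re_le_norm _)
      simp [hs]; norm_num
    exact div_le_one_of_le₀ this (norm_nonneg _)
  · have := ArithmeticFunction.LSeries_vonMangoldt_eq_deriv_riemannZeta_div hs1
    rw [neg_div] at this
    rw [← norm_neg, ← this]
    exact norm_LSeries_le_of_re_le_re (ArithmeticFunction.LSeriesSummable_vonMangoldt h2)
      (by simp [hs])

/-- The branch of `log (ζ(s)(s-1))` on a disc around `c`, normalised to vanish at `c`. -/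
theorem exists_log_of_ne_zero {H : ℂ → ℂ} {c : ℂ} {r : ℝ} (hr : 0 < r) (hd : Differentiable ℂ H)
    (h0 : ∀ s ∈ Metric.ball c r, H s ≠ 0) :
    ∃ l : ℂ → ℂ, l c = 0 ∧ (∀ s ∈ Metric.ball c r, HasDerivAt l (logDeriv H s) s) ∧
      ∀ s ∈ Metric.ball c r, H s = H c * Complex.exp (l s) := by
  have hL : DifferentiableOn ℂ (logDeriv H) (Metric.ball c r) := by
    intro s hs
    have : DifferentiableAt ℂ (deriv H) s :=
      (hd.analyticAt s).deriv.differentiableAt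
    exact (this.div (hd s) (h0 s hs)).differentiableWithinAt
  obtain ⟨l, hl, hl'⟩ := hL.isExactOn_ball.with_val_at c 0
  refine ⟨l, hl, hl', fun s hs => ?_⟩
  have key : ∀ z ∈ Metric.ball c r, HasDerivAt (fun z => H z * Complex.exp (-l z)) 0 z := by
    intro z hz
    have : HasDerivAt (fun z => H z * Complex.exp (-l z)) _ z :=
      (hd z).hasDerivAt.mul (hl' z hz).neg.cexp
    refine this.congr_deriv ?_
    have := h0 z hz
    rw [logDeriv_apply]
    simp only [Pi.neg_apply]
    field_simp
    ring
  have := Metric.isOpen_ball.is_const_of_deriv_eq_zero (convex_ball c r).isPreconnected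
    (fun z hz => (key z hz).differentiableAt.differentiableWithinAt)
    (fun z hz => (key z hz).deriv) hs (Metric.mem_ball_self hr)
  simp only [hl, neg_zero, Complex.exp_zero, mul_one] at this
  rw [← this, mul_assoc, ← Complex.exp_add]
  simp

theorem mem_ball_two_add_mul_I {t : ℝ} {s : ℂ} {r : ℝ} (hs : s ∈ Metric.ball (2 + t * Complex.I) r) :
    2 - r < s.re := by
  have h := (Complex.abs_re_le_norm (s - (2 + t * Complex.I))).trans_lt (mem_ball_iff_norm.1 hs)
  simp at h
  linarith [(abs_lt.1 h).1]

theorem one_le_log_four_add (t : ℝ) : 1 ≤ Real.log (4 + |t|) := by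
  rw [Real.le_log_iff_exp_le (by positivity)]
  have := Real.exp_one_lt_d9
  linarith [abs_nonneg t]

/-- A disc of radius `3/2` about a point of the line `Re s = 2`, with a logarithm of `zetaReg`. -/
structure IsZetaLog (t : ℝ) (l : ℂ → ℂ) : Prop where
  zero : l (2 + t * Complex.I) = 0
  hasDerivAt : ∀ s ∈ Metric.ball (2 + t * Complex.I) (3 / 2),
    HasDerivAt l (logDeriv zetaReg s) s
  eq_mul_exp : ∀ s ∈ Metric.ball (2 + t * Complex.I) (3 / 2),
    zetaReg s = zetaReg (2 + t * Complex.I) * Complex.exp (l s)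

theorem exists_isZetaLog
    (hRH : ∀ ρ : ℂ, riemannZeta ρ = 0 → 0 < ρ.re → ρ.re < 1 → ρ.re = 1 / 2) (t : ℝ) :
    ∃ l, IsZetaLog t l := by
  obtain ⟨l, h1, h2, h3⟩ := exists_log_of_ne_zero (c := 2 + t * Complex.I) (r := 3 / 2)
    (by norm_num) differentiable_zetaReg
    (fun s hs => zetaReg_ne_zero hRH (by linarith [mem_ball_two_add_mul_I hs]))
  exact ⟨l, h1, h2, h3⟩

theorem zetaReg_two_add_mul_I (t : ℝ) :
    zetaReg (2 + t * Complex.I) = (1 + t * Complex.I) * riemannZeta (2 + t * Complex.I) := by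
  rw [zetaReg_of_ne]
  · ring
  · intro h
    have := congrArg Complex.re h
    simp at this

theorem one_le_norm_one_add_mul_I (t : ℝ) : 1 ≤ ‖(1 + t * Complex.I : ℂ)‖ := by
  simpa using Complex.re_le_norm (1 + t * Complex.I : ℂ)

theorem exists_norm_isZetaLog_le {δ : ℝ} (hδ : 0 < δ) :
    ∃ C : ℝ, 0 < C ∧ ∀ (t : ℝ) (l : ℂ → ℂ), IsZetaLog t l →
      ∀ s ∈ Metric.closedBall (2 + t * Complex.I) (3 / 2 - δ), ‖l s‖ ≤ C * Real.log (4 + |t|) := by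
  obtain ⟨M, hM1, hM⟩ := exists_norm_riemannZeta_le (σ := 2) (by norm_num)
  set A := Real.log (2 * M) + 6
  have hA : 0 < A := add_pos_of_nonneg_of_pos (Real.log_nonneg (by linarith)) (by norm_num)
  refine ⟨2 * A * (3 / 2) / δ, by positivity, fun t l hl s hs => ?_⟩
  set c : ℂ := 2 + t * Complex.I
  set lg := Real.log (4 + |t|)
  have hlg : 1 ≤ lg := one_le_log_four_add t
  have hcre : c.re = 2 := by simp [c]
  have hre : ∀ z ∈ Metric.ball c (3 / 2), (l z).re ≤ A * lg := by
    intro z hz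
    have hz0 : 0 < z.re := by linarith [mem_ball_two_add_mul_I hz]
    have hzn : ‖z‖ + 1 ≤ (4 + |t|) ^ 2 := by
      have h1 : ‖z‖ ≤ ‖z - c‖ + ‖c‖ := by simpa using norm_add_le (z - c) c
      have h2 : ‖c‖ ≤ 2 + |t| := by simpa [c] using norm_add_le (2 : ℂ) (t * Complex.I)
      have h3 := mem_ball_iff_norm.1 hz
      nlinarith [abs_nonneg t]
    have hHc : M⁻¹ ≤ ‖zetaReg c‖ := by
      rw [zetaReg_two_add_mul_I, norm_mul]
      have h1 := (hM c hcre.ge).2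
      rw [norm_inv] at h1
      have h2 : riemannZeta c ≠ 0 := riemannZeta_ne_zero_of_one_le_re (by rw [hcre]; norm_num)
      have h3 : M⁻¹ ≤ ‖riemannZeta c‖ := inv_le_of_inv_le₀ (norm_pos_iff.2 h2) h1
      nlinarith [one_le_norm_one_add_mul_I t, norm_nonneg (riemannZeta c)]
    have hexp : Real.exp (l z).re ≤ 2 * M * (4 + |t|) ^ 6 := by
      have h1 := congrArg norm (hl.eq_mul_exp z hz)
      rw [norm_mul, Complex.norm_exp] at h1
      have h2 := norm_zetaReg_le hz0
      have h3 : M⁻¹ * Real.exp (l z).re ≤ 2 * ((4 + |t|) ^ 2) ^ 3 :=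
        calc _ ≤ ‖zetaReg c‖ * Real.exp (l z).re := by gcongr
          _ = ‖zetaReg z‖ := h1.symm
          _ ≤ 2 * (‖z‖ + 1) ^ 3 := h2
          _ ≤ _ := by gcongr
      have hM0 : 0 < M := by linarith
      rw [inv_mul_le_iff₀ hM0] at h3
      calc _ ≤ _ := h3
        _ = _ := by ring
    have h4 : (0 : ℝ) < 4 + |t| := by positivity
    have h5 := (Real.le_log_iff_exp_le (by positivity)).2 hexp
    rw [Real.log_mul (by positivity) (by positivity), Real.log_pow] at h5
    have : 0 ≤ Real.log (2 * M) := Real.log_nonneg (by linarith)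
    push_cast at h5
    calc _ ≤ _ := h5
      _ ≤ A * lg := by simp only [A, lg] at *; nlinarith
  have hs' : s - c ∈ Metric.ball (0 : ℂ) (3 / 2) := by
    have := mem_closedBall_iff_norm.1 hs
    simp only [mem_ball_zero_iff]; linarith
  have hadd : ∀ w ∈ Metric.ball (0 : ℂ) (3 / 2), w + c ∈ Metric.ball c (3 / 2) := by
    intro w hw
    simpa using hw
  have hb := Complex.borelCaratheodory_zero (f := fun w => l (w + c)) (M := A * lg) (R := 3 / 2)
    (z := s - c) (by positivity)
    (fun w hw => by
      have := (hl.hasDerivAt (w + c) (hadd w hw)).comp_add_const w c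
      exact this.differentiableAt.differentiableWithinAt)
    (fun w hw => hre _ (hadd w hw)) (by norm_num) hs' (by simpa using hl.zero)
  simp only [sub_add_cancel] at hb
  have h1 := mem_closedBall_iff_norm.1 hs
  refine hb.trans ?_
  calc 2 * (A * lg) * ‖s - c‖ / (3 / 2 - ‖s - c‖) ≤ 2 * (A * lg) * (3 / 2) / δ := by
        gcongr <;> linarith
    _ = _ := by ring

theorem differentiableAt_logDeriv_zetaReg
    (hRH : ∀ ρ : ℂ, riemannZeta ρ = 0 → 0 < ρ.re → ρ.re < 1 → ρ.re = 1 / 2)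
    {s : ℂ} (hs : 1 / 2 < s.re) : DifferentiableAt ℂ (logDeriv zetaReg) s :=
  (differentiable_zetaReg.analyticAt s).deriv.differentiableAt.div (differentiable_zetaReg s)
    (zetaReg_ne_zero hRH hs)

theorem sub_two_add_im_mul_I (s : ℂ) : s - (2 + s.im * Complex.I) = ((s.re - 2 : ℝ) : ℂ) := by
  apply Complex.ext <;> simp

theorem exists_norm_logDeriv_zetaReg_le_log
    (hRH : ∀ ρ : ℂ, riemannZeta ρ = 0 → 0 < ρ.re → ρ.re < 1 → ρ.re = 1 / 2)
    {δ : ℝ} (hδ : 0 < δ) :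
    ∃ C : ℝ, 1 ≤ C ∧ ∀ s : ℂ, 1 / 2 + δ ≤ s.re → s.re ≤ 2 →
      ‖logDeriv zetaReg s‖ ≤ C * Real.log (4 + |s.im|) := by
  obtain ⟨C, hC, h⟩ := exists_norm_isZetaLog_le (δ := δ / 2) (by positivity)
  refine ⟨max 1 (C / (δ / 2)), le_max_left _ _, fun s h1 h2 => ?_⟩
  obtain ⟨l, hl⟩ := exists_isZetaLog hRH s.im
  set c : ℂ := 2 + s.im * Complex.I
  have hsc : ‖s - c‖ ≤ 3 / 2 - δ := by
    rw [sub_two_add_im_mul_I, Complex.norm_real, Real.norm_eq_abs, abs_of_nonpos] <;> linarith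
  have hsub : Metric.closedBall s (δ / 2) ⊆ Metric.closedBall c (3 / 2 - δ / 2) :=
    Metric.closedBall_subset_closedBall' (by rw [dist_eq_norm]; linarith)
  have hsub' : Metric.closedBall c (3 / 2 - δ / 2) ⊆ Metric.ball c (3 / 2) :=
    Metric.closedBall_subset_ball (by linarith)
  have hd : DifferentiableOn ℂ l (Metric.closedBall s (δ / 2)) := fun z hz =>
    (hl.hasDerivAt z (hsub' (hsub hz))).differentiableAt.differentiableWithinAt
  have hb := Complex.norm_deriv_le_of_forall_mem_sphere_norm_le (f := l) (c := s) (R := δ / 2)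
    (C := C * Real.log (4 + |s.im|)) (by positivity) (hd.diffContOnCl_ball subset_rfl)
    (fun z hz => h s.im l hl z (hsub (Metric.sphere_subset_closedBall hz)))
  rw [(hl.hasDerivAt s (hsub' (hsub (Metric.mem_closedBall_self (by positivity))))).deriv] at hb
  have := one_le_log_four_add s.im
  calc _ ≤ _ := hb
    _ = C / (δ / 2) * Real.log (4 + |s.im|) := by ring
    _ ≤ _ := by gcongr; exact le_max_right _ _

theorem log_four_add_abs_le (t t₀ : ℝ) :
    Real.log (4 + |t|) ≤ Real.log (4 + |t₀|) * (1 + |t - t₀|) := by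
  have h1 : 4 + |t| ≤ (4 + |t₀|) * (1 + |t - t₀|) := by
    have : |t| ≤ |t - t₀| + |t₀| := by simpa using abs_add_le (t - t₀) t₀
    nlinarith [abs_nonneg (t - t₀), abs_nonneg t₀]
  have h2 := Real.log_le_log (by positivity) h1
  rw [Real.log_mul (by positivity) (by positivity)] at h2
  have h3 := Real.log_le_sub_one_of_pos (show (0 : ℝ) < 1 + |t - t₀| by positivity)
  nlinarith [one_le_log_four_add t₀, abs_nonneg (t - t₀)]

theorem one_add_mul_exp_neg_sq_le (u : ℝ) : (1 + u) * Real.exp (-u ^ 2) ≤ 2 := by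
  rw [Real.exp_neg, ← div_eq_mul_inv, div_le_iff₀ (Real.exp_pos _)]
  have := Real.add_one_le_exp (u ^ 2)
  nlinarith [sq_nonneg (u - 1)]

/-- Littlewood's bound for `ζ'/ζ` to the right of the critical line. -/
theorem exists_norm_logDeriv_zetaReg_le_rpow_log
    (hRH : ∀ ρ : ℂ, riemannZeta ρ = 0 → 0 < ρ.re → ρ.re < 1 → ρ.re = 1 / 2)
    {δ : ℝ} (hδ : 0 < δ) (hδ' : δ < 3 / 2) :
    ∃ C θ : ℝ, 0 < C ∧ 0 < θ ∧ ∀ s : ℂ, 1 / 2 + 2 * δ ≤ s.re → s.re ≤ 2 →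
      ‖logDeriv zetaReg s‖ ≤ C * Real.log (4 + |s.im|) ^ (1 - θ) := by
  obtain ⟨C, hC1, hC⟩ := exists_norm_logDeriv_zetaReg_le_log hRH hδ
  obtain ⟨M, hM1, hM⟩ := exists_norm_logDeriv_zetaReg_le
  set A := C * 2 * Real.exp 4
  set B := M * Real.exp 4
  have he : 1 ≤ Real.exp 4 := Real.one_le_exp (by norm_num)
  have hA : 1 ≤ A := by simp only [A]; nlinarith
  have hB : 1 ≤ B := by simp only [B]; nlinarith
  refine ⟨A * B, δ / (3 / 2 - δ), by positivity, div_pos hδ (by linarith), fun s₀ h1 h2 => ?_⟩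
  set lg := Real.log (4 + |s₀.im|)
  have hlg : 1 ≤ lg := one_le_log_four_add _
  set F : ℂ → ℂ := fun s => logDeriv zetaReg s * Complex.exp ((s - s₀.im * Complex.I) ^ 2)
  have hFn : ∀ s : ℂ, ‖F s‖ =
      ‖logDeriv zetaReg s‖ * Real.exp (s.re ^ 2 - (s.im - s₀.im) ^ 2) := by
    intro s
    simp only [F, norm_mul, Complex.norm_exp]
    congr 2
    simp [pow_two]
  have hle : ∀ s : ℂ, 1 / 2 + δ ≤ s.re → s.re ≤ 2 → ‖F s‖ ≤ A * lg := by
    intro s hs1 hs2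
    rw [hFn]
    have e1 : Real.exp (s.re ^ 2 - (s.im - s₀.im) ^ 2) ≤
        Real.exp 4 * Real.exp (-|s.im - s₀.im| ^ 2) := by
      rw [← Real.exp_add, sq_abs]
      apply Real.exp_le_exp.2
      nlinarith
    calc _ ≤ (C * (lg * (1 + |s.im - s₀.im|))) *
          (Real.exp 4 * Real.exp (-|s.im - s₀.im| ^ 2)) := by
          gcongr
          refine (hC s hs1 hs2).trans ?_
          gcongr
          exact log_four_add_abs_le _ _
      _ = C * lg * Real.exp 4 * ((1 + |s.im - s₀.im|) * Real.exp (-|s.im - s₀.im| ^ 2)) := by ring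
      _ ≤ C * lg * Real.exp 4 * 2 := by
          gcongr
          exact one_add_mul_exp_neg_sq_le _
      _ = _ := by simp only [A]; ring
  have hle2 : ∀ s : ℂ, s.re = 2 → ‖F s‖ ≤ B := by
    intro s hs
    rw [hFn]
    have : Real.exp (s.re ^ 2 - (s.im - s₀.im) ^ 2) ≤ Real.exp 4 := by
      apply Real.exp_le_exp.2
      rw [hs]
      nlinarith [sq_nonneg (s.im - s₀.im)]
    exact mul_le_mul (hM s hs) this (Real.exp_pos _).le (by linarith)
  have hd : DiffContOnCl ℂ F (Complex.HadamardThreeLines.verticalStrip (1 / 2 + δ) 2) := by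
    apply DifferentiableOn.diffContOnCl
    intro s hs
    have hs' : 1 / 2 + δ ≤ s.re := by
      have := closure_mono (Set.preimage_mono Set.Ioo_subset_Icc_self) hs
      rw [(isClosed_Icc.preimage Complex.continuous_re).closure_eq] at this
      exact this.1
    exact ((differentiableAt_logDeriv_zetaReg hRH (by linarith)).mul
      (by fun_prop)).differentiableWithinAt
  have h3 := Complex.HadamardThreeLines.norm_le_interp_of_mem_verticalClosedStrip' (f := F)
    (z := s₀) (a := A * lg) (b := B) (l := 1 / 2 + δ) (u := 2) (by linarith)
    ⟨by linarith, h2⟩ hd ⟨A * lg, by rintro _ ⟨s, hs, rfl⟩; exact hle s hs.1 hs.2⟩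
    (fun s hs => by
      have : s.re = 1 / 2 + δ := hs
      exact hle s this.ge (by linarith))
    (fun s hs => hle2 s hs)
  set u := (s₀.re - (1 / 2 + δ)) / (2 - (1 / 2 + δ))
  have hu : δ / (3 / 2 - δ) ≤ u := by
    simp only [u]
    have : 2 - (1 / 2 + δ) = 3 / 2 - δ := by ring
    rw [this]
    have : 0 < 3 / 2 - δ := by linarith
    gcongr
    linarith
  have hu0 : 0 ≤ u := le_trans (div_nonneg hδ.le (by linarith)) hu
  have hu1 : u ≤ 1 := by
    simp only [u]
    rw [div_le_one (by linarith)]; linarith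
  have hF0 : ‖logDeriv zetaReg s₀‖ ≤ ‖F s₀‖ := by
    rw [hFn]
    refine le_mul_of_one_le_right (norm_nonneg _) (Real.one_le_exp ?_)
    nlinarith [sq_nonneg s₀.re]
  calc _ ≤ _ := hF0
    _ ≤ _ := h3
    _ = A ^ (1 - u) * lg ^ (1 - u) * B ^ u := by
      rw [Real.mul_rpow (by linarith) (by linarith)]
    _ ≤ A ^ (1 : ℝ) * lg ^ (1 - δ / (3 / 2 - δ)) * B ^ (1 : ℝ) := by
      gcongr
      all_goals linarith
    _ = _ := by rw [Real.rpow_one, Real.rpow_one]; ring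

theorem exists_mul_rpow_le_mul_add {C θ η : ℝ} (hC : 0 < C) (hθ : 0 < θ) (hη : 0 < η) :
    ∃ D : ℝ, 0 ≤ D ∧ ∀ X : ℝ, 1 ≤ X → C * X ^ (1 - θ) ≤ η * X + D := by
  set X₀ := max 1 ((C / η) ^ (1 / θ))
  refine ⟨C * X₀, by positivity, fun X hX => ?_⟩
  rcases le_total X X₀ with h | h
  · have : X ^ (1 - θ) ≤ X₀ := by
      refine le_trans ?_ h
      calc X ^ (1 - θ) ≤ X ^ (1 : ℝ) := Real.rpow_le_rpow_of_exponent_le hX (by linarith)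
        _ = X := Real.rpow_one X
    nlinarith
  · have h1 : (C / η) ^ (1 / θ) ≤ X := (le_max_right _ _).trans h
    have h2 : C / η ≤ X ^ θ := by
      calc C / η = ((C / η) ^ (1 / θ)) ^ θ := by
            rw [← Real.rpow_mul (by positivity), one_div_mul_cancel hθ.ne', Real.rpow_one]
        _ ≤ _ := by gcongr
    have h3 : X = X ^ (1 - θ) * X ^ θ := by
      rw [← Real.rpow_add (by linarith)]; simp
    have h4 : 0 ≤ X ^ (1 - θ) := by positivity
    have h5 : C ≤ η * X ^ θ := by rw [div_le_iff₀ hη] at h2; linarith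
    have : 0 ≤ C * X₀ := by positivity
    calc C * X ^ (1 - θ) ≤ (η * X ^ θ) * X ^ (1 - θ) := by gcongr
      _ = η * X := by nth_rewrite 3 [h3]; ring
      _ ≤ _ := by linarith

theorem exists_norm_isZetaLog_le_log
    (hRH : ∀ ρ : ℂ, riemannZeta ρ = 0 → 0 < ρ.re → ρ.re < 1 → ρ.re = 1 / 2)
    {δ η : ℝ} (hδ : 0 < δ) (hη : 0 < η) :
    ∃ D : ℝ, 0 ≤ D ∧ ∀ s : ℂ, 1 / 2 + δ ≤ s.re → s.re ≤ 2 → ∀ l, IsZetaLog s.im l →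
      ‖l s‖ ≤ η * Real.log (4 + |s.im|) + D := by
  wlog h : δ < 3 / 2 generalizing δ
  · obtain ⟨D, hD, H⟩ := this (δ := 1) one_pos (by norm_num)
    exact ⟨D, hD, fun s h1 h2 => H s (by linarith) h2⟩
  obtain ⟨C, θ, hC, hθ, hb⟩ := exists_norm_logDeriv_zetaReg_le_rpow_log hRH (δ := δ / 2)
    (by positivity) (by linarith)
  obtain ⟨D, hD, hD'⟩ := exists_mul_rpow_le_mul_add hC hθ (η := η / (3 / 2)) (by positivity)
  refine ⟨D * (3 / 2), by positivity, fun s h1 h2 l hl => ?_⟩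
  set c : ℂ := 2 + s.im * Complex.I
  have hsc : ‖s - c‖ ≤ 3 / 2 - δ := by
    rw [sub_two_add_im_mul_I, Complex.norm_real, Real.norm_eq_abs, abs_of_nonpos] <;> linarith
  have hseg : ∀ z ∈ segment ℝ c s, z.im = s.im ∧ s.re ≤ z.re ∧ z.re ≤ 2 := by
    rintro z ⟨a, b, ha, hb, hab, rfl⟩
    have hb' : b = 1 - a := by linarith
    subst hb'
    refine ⟨?_, ?_, ?_⟩
    · simp [c]; ring
    · simp [c]; nlinarith
    · simp [c]; nlinarith
  have hball : segment ℝ c s ⊆ Metric.ball c (3 / 2) :=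
    (convex_ball c _).segment_subset (Metric.mem_ball_self (by norm_num))
      (mem_ball_iff_norm.2 (by linarith))
  have hK : ∀ z ∈ segment ℝ c s, ‖logDeriv zetaReg z‖ ≤
      η / (3 / 2) * Real.log (4 + |s.im|) + D := by
    intro z hz
    obtain ⟨e1, e2, e3⟩ := hseg z hz
    refine (hb z (by linarith) e3).trans ?_
    rw [e1]
    exact hD' _ (one_le_log_four_add _)
  have := Convex.norm_image_sub_le_of_norm_hasDerivWithin_le (𝕜 := ℂ) (f := l)
    (fun z hz => (hl.hasDerivAt z (hball hz)).hasDerivWithinAt) hK (convex_segment c s)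
    (left_mem_segment ℝ c s) (right_mem_segment ℝ c s)
  rw [hl.zero, sub_zero] at this
  have hlg := one_le_log_four_add s.im
  calc _ ≤ _ := this
    _ ≤ (η / (3 / 2) * Real.log (4 + |s.im|) + D) * (3 / 2) := by
      gcongr
      linarith
    _ = _ := by ring

theorem exists_exp_norm_isZetaLog_le
    (hRH : ∀ ρ : ℂ, riemannZeta ρ = 0 → 0 < ρ.re → ρ.re < 1 → ρ.re = 1 / 2)
    {δ η : ℝ} (hδ : 0 < δ) (hη : 0 < η) :
    ∃ D : ℝ, 0 < D ∧ ∀ s : ℂ, 1 / 2 + δ ≤ s.re → s.re ≤ 2 →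
      ∃ l, zetaReg s = zetaReg (2 + s.im * Complex.I) * Complex.exp l ∧
        Real.exp ‖l‖ ≤ D * (4 + |s.im|) ^ η := by
  obtain ⟨D, hD, h⟩ := exists_norm_isZetaLog_le_log hRH hδ hη
  refine ⟨Real.exp D, Real.exp_pos _, fun s h1 h2 => ?_⟩
  obtain ⟨l, hl⟩ := exists_isZetaLog hRH s.im
  refine ⟨l s, hl.eq_mul_exp s ?_, ?_⟩
  · rw [mem_ball_iff_norm, sub_two_add_im_mul_I, Complex.norm_real, Real.norm_eq_abs,
      abs_of_nonpos] <;> linarith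
  · have := Real.exp_le_exp.2 (h s h1 h2 l hl)
    rwa [Real.exp_add, mul_comm, mul_comm η, Real.exp_mul, Real.exp_log (by positivity)] at this

theorem norm_exp_le_exp_norm (l : ℂ) : ‖Complex.exp l‖ ≤ Real.exp ‖l‖ := by
  rw [Complex.norm_exp]
  exact Real.exp_le_exp.2 (Complex.re_le_norm l)

/-- `1/ζ`, with the removable singularity at `1` removed. -/
noncomputable def zetaInv (s : ℂ) : ℂ := (s - 1) / zetaReg s

theorem zetaInv_eq {s : ℂ} (hs : s ≠ 1) : zetaInv s = (riemannZeta s)⁻¹ := by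
  have := sub_ne_zero.2 hs
  rw [zetaInv, zetaReg_of_ne hs, ← div_div, div_self this, one_div]

theorem differentiableAt_zetaInv
    (hRH : ∀ ρ : ℂ, riemannZeta ρ = 0 → 0 < ρ.re → ρ.re < 1 → ρ.re = 1 / 2)
    {s : ℂ} (hs : 1 / 2 < s.re) : DifferentiableAt ℂ zetaInv s :=
  (by fun_prop : DifferentiableAt ℂ (fun s : ℂ => s - 1) s).div (differentiable_zetaReg s)
    (zetaReg_ne_zero hRH hs)

/-- Littlewood: under RH, `1/ζ(s)` grows slower than every power of `Im s`. -/
theorem exists_norm_zetaInv_le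
    (hRH : ∀ ρ : ℂ, riemannZeta ρ = 0 → 0 < ρ.re → ρ.re < 1 → ρ.re = 1 / 2)
    {δ η : ℝ} (hδ : 0 < δ) (hη : 0 < η) :
    ∃ D : ℝ, 0 < D ∧ ∀ s : ℂ, 1 / 2 + δ ≤ s.re → ‖zetaInv s‖ ≤ D * (4 + |s.im|) ^ η := by
  obtain ⟨D, hD, h⟩ := exists_exp_norm_isZetaLog_le hRH hδ hη
  obtain ⟨M, hM1, hM⟩ := exists_norm_riemannZeta_le (σ := 2) (by norm_num)
  refine ⟨max M (M * D), by positivity, fun s hs => ?_⟩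
  have hpow : 1 ≤ (4 + |s.im|) ^ η := Real.one_le_rpow (by linarith [abs_nonneg s.im]) hη.le
  rcases le_total s.re 2 with h2 | h2
  · obtain ⟨l, hl, hle⟩ := h s hs h2
    rw [zetaInv, hl, zetaReg_two_add_mul_I, norm_div, norm_mul, norm_mul, Complex.norm_exp]
    have h3 : ‖s - 1‖ ≤ ‖(1 + s.im * Complex.I : ℂ)‖ := by
      rw [← sq_le_sq₀ (norm_nonneg _) (norm_nonneg _), Complex.sq_norm, Complex.sq_norm,
        Complex.normSq_apply, Complex.normSq_apply]
      simp
      nlinarith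
    have h4 := one_le_norm_one_add_mul_I s.im
    have h5 := (hM (2 + s.im * Complex.I) (by simp)).2
    rw [norm_inv] at h5
    have h6 : Real.exp (-l.re) ≤ Real.exp ‖l‖ :=
      Real.exp_le_exp.2 (by simpa using Complex.re_le_norm (-l))
    calc _ = ‖s - 1‖ / ‖(1 + s.im * Complex.I : ℂ)‖ * ‖riemannZeta (2 + s.im * Complex.I)‖⁻¹ *
          Real.exp (-l.re) := by rw [Real.exp_neg]; ring
      _ ≤ 1 * M * (D * (4 + |s.im|) ^ η) := by
        gcongr
        · exact div_le_one_of_le₀ h3 (norm_nonneg _)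
        · exact h6.trans hle
      _ = M * D * (4 + |s.im|) ^ η := by ring
      _ ≤ _ := by gcongr; exact le_max_right _ _
  · rw [zetaInv_eq (by rintro rfl; norm_num at h2)]
    calc _ ≤ M * 1 := by simpa using (hM s h2).2
      _ ≤ _ := by gcongr; exact le_max_left _ _

/-- Lindelöf's hypothesis off the critical line, under RH. -/
theorem exists_norm_riemannZeta_le_rpow
    (hRH : ∀ ρ : ℂ, riemannZeta ρ = 0 → 0 < ρ.re → ρ.re < 1 → ρ.re = 1 / 2)
    {δ η : ℝ} (hδ : 0 < δ) (hδ' : δ < 1 / 4) (hη : 0 < η) :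
    ∃ D : ℝ, 0 < D ∧ ∀ s : ℂ, s.re = 1 / 2 + δ → ‖riemannZeta s‖ ≤ D * (4 + |s.im|) ^ η := by
  obtain ⟨D, hD, h⟩ := exists_exp_norm_isZetaLog_le hRH hδ hη
  obtain ⟨M, hM1, hM⟩ := exists_norm_riemannZeta_le (σ := 2) (by norm_num)
  refine ⟨4 * M * D, by positivity, fun s hs => ?_⟩
  obtain ⟨l, hl, hle⟩ := h s hs.ge (by linarith)
  have hs1 : s ≠ 1 := by rintro rfl; norm_num at hs; linarith
  have hs1' : 0 < ‖s - 1‖ := norm_pos_iff.2 (sub_ne_zero.2 hs1)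
  rw [zetaReg_of_ne hs1, zetaReg_two_add_mul_I] at hl
  have h1 := congrArg norm hl
  rw [norm_mul, norm_mul, norm_mul] at h1
  have h3 : ‖(1 + s.im * Complex.I : ℂ)‖ ≤ 4 * ‖s - 1‖ := by
    rw [← sq_le_sq₀ (norm_nonneg _) (by positivity), mul_pow, Complex.sq_norm, Complex.sq_norm,
        Complex.normSq_apply, Complex.normSq_apply]
    have h4 : 1 / 16 ≤ ((1 / 2 + δ) - 1) * ((1 / 2 + δ) - 1) := by nlinarith
    simp only [Complex.add_re, Complex.add_im, Complex.one_re, Complex.one_im, Complex.mul_re,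
      Complex.mul_im, Complex.I_re, Complex.I_im, Complex.ofReal_re, Complex.ofReal_im,
      Complex.sub_re, Complex.sub_im, hs]
    ring_nf at h4 ⊢
    nlinarith [sq_nonneg s.im]
  have h5 := (hM (2 + s.im * Complex.I) (by simp)).1
  have h6 : ‖s - 1‖ * ‖riemannZeta s‖ ≤ ‖s - 1‖ * (4 * M * D * (4 + |s.im|) ^ η) :=
    calc _ = _ := h1
      _ ≤ 4 * ‖s - 1‖ * M * (D * (4 + |s.im|) ^ η) := by
        gcongr
        exact (norm_exp_le_exp_norm l).trans hle
      _ = _ := by ring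
  exact (mul_le_mul_iff_right₀ hs1').1 h6

/-- Shifting a contour between two vertical lines. -/
theorem integral_verticalLine_eq {f : ℂ → ℂ} {a b C r : ℝ} (hab : a ≤ b) (hr : 1 < r)
    (hf : ∀ w : ℂ, a ≤ w.re → w.re ≤ b → DifferentiableAt ℂ f w)
    (hC : ∀ w : ℂ, a ≤ w.re → w.re ≤ b → ‖f w‖ ≤ C * (1 + |w.im|) ^ (-r)) :
    ∫ τ : ℝ, f (a + τ * Complex.I) = ∫ τ : ℝ, f (b + τ * Complex.I) := by
  have hInt : ∀ x : ℝ, a ≤ x → x ≤ b → MeasureTheory.Integrable fun τ : ℝ => f (x + τ * Complex.I) := by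
    intro x h1 h2
    refine integrable_of_le_one_add_abs_rpow (C := C) ?_ hr fun τ => ?_
    · rw [continuous_iff_continuousAt]
      intro τ
      exact ContinuousAt.comp (f := fun τ : ℝ => (x + τ * Complex.I : ℂ))
        (hf (x + τ * Complex.I) (by simpa using h1) (by simpa using h2)).continuousAt (by fun_prop)
    · simpa using hC (x + τ * Complex.I) (by simpa using h1) (by simpa using h2)
  have hlim : ∀ x : ℝ, a ≤ x → x ≤ b → Tendsto (fun T : ℝ => ∫ τ in (-T)..T, f (x + τ * Complex.I))
      atTop (nhds (∫ τ : ℝ, f (x + τ * Complex.I))) := fun x h1 h2 =>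
    MeasureTheory.intervalIntegral_tendsto_integral (hInt x h1 h2) tendsto_neg_atTop_atBot tendsto_id
  have hhor : ∀ σ : ℝ, |σ| = 1 →
      Tendsto (fun T : ℝ => ∫ x in a..b, f (x + ((σ * T : ℝ) : ℂ) * Complex.I)) atTop (nhds 0) := by
    intro σ hσ
    have h0 : Tendsto (fun T : ℝ => C * (1 + T) ^ (-r) * |b - a|) atTop (nhds 0) := by
      have := (tendsto_rpow_neg_atTop (show 0 < r by linarith)).comp
        (tendsto_atTop_add_const_left atTop (1 : ℝ) tendsto_id)
      simpa using (this.const_mul C).mul_const |b - a|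
    refine squeeze_zero_norm' ?_ h0
    filter_upwards [eventually_ge_atTop 0] with T hT
    refine intervalIntegral.norm_integral_le_of_norm_le_const fun x hx => ?_
    rw [Set.uIoc_of_le hab] at hx
    have := hC (x + ((σ * T : ℝ) : ℂ) * Complex.I) (by simpa using hx.1.le) (by simpa using hx.2)
    simpa [abs_mul, hσ, abs_of_nonneg hT] using this
  have hrect : ∀ T : ℝ, ((∫ x in a..b, f (x + ((-1 * T : ℝ) : ℂ) * Complex.I)) -
      ∫ x in a..b, f (x + ((1 * T : ℝ) : ℂ) * Complex.I)) +
      Complex.I • (∫ τ in (-T)..T, f (b + τ * Complex.I)) -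
      Complex.I • (∫ τ in (-T)..T, f (a + τ * Complex.I)) = 0 := by
    intro T
    have := Complex.integral_boundary_rect_eq_zero_of_differentiableOn f
      ⟨a, -T⟩ ⟨b, T⟩ (fun w hw => by
        rw [Set.uIcc_of_le hab] at hw
        exact (hf w hw.1.1 hw.1.2).differentiableWithinAt)
    simpa using this
  have hl := ((((hhor (-1) (by simp)).sub (hhor 1 (by simp))).add
    ((hlim b hab le_rfl).const_smul Complex.I)).sub ((hlim a le_rfl hab).const_smul Complex.I))
  simp_rw [hrect] at hl
  have := tendsto_nhds_unique hl tendsto_const_nhds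
  simp only [sub_zero, zero_add, smul_eq_mul, ← mul_sub] at this
  exact (sub_eq_zero.1 ((mul_eq_zero.1 this).resolve_left Complex.I_ne_zero)).symm

/-- The Dirichlet convolution `μ * μ`, with Dirichlet series `ζ⁻²`. -/
def moebiusSq : ArithmeticFunction ℤ := ArithmeticFunction.moebius * ArithmeticFunction.moebius

theorem moebiusSq_coe :
    (fun n => ((moebiusSq n : ℤ) : ℂ)) = fun n =>
      ((((ArithmeticFunction.moebius : ArithmeticFunction ℤ) : ArithmeticFunction ℂ) *
        ((ArithmeticFunction.moebius : ArithmeticFunction ℤ) : ArithmeticFunction ℂ)) n) := by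
  ext n
  rw [moebiusSq, ← ArithmeticFunction.intCoe_mul, ArithmeticFunction.intCoe_apply]

theorem LSeriesSummable_moebiusSq {s : ℂ} (hs : 1 < s.re) :
    LSeriesSummable (fun n => (moebiusSq n : ℂ)) s := by
  rw [moebiusSq_coe]
  have := ArithmeticFunction.LSeriesSummable_moebius_iff.2 hs
  exact ArithmeticFunction.LSeriesSummable_mul (by simpa using this) (by simpa using this)

theorem LSeries_moebiusSq {s : ℂ} (hs : 1 < s.re) :
    LSeries (fun n => (moebiusSq n : ℂ)) s = zetaInv s ^ 2 := by
  have h1 : s ≠ 1 := by rintro rfl; simp at hs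
  have e : zetaInv s = LSeries (fun n => (ArithmeticFunction.moebius n : ℂ)) s := by
    rw [zetaInv_eq h1, inv_eq_of_mul_eq_one_right]
    rw [← LSeries_one_eq_riemannZeta hs]
    exact LSeries_one_mul_Lseries_moebius hs
  have := ArithmeticFunction.LSeriesSummable_moebius_iff.2 hs
  rw [moebiusSq_coe, ArithmeticFunction.LSeries_mul' (by simpa using this) (by simpa using this), e,
    sq]
  simp

theorem continuous_verticalLine_rieszKernel {c : ℝ} (hc : 0 < c) : Continuous fun τ : ℝ =>
    1 / (((c : ℂ) + τ * Complex.I) * ((c : ℂ) + τ * Complex.I + 1)) :=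
  continuous_const.div (by fun_prop) fun τ =>
      mul_ne_zero (verticalLine_ne_zero hc τ) (verticalLine_add_one_ne_zero hc τ)

theorem integrable_verticalLine_rieszKernel {c : ℝ} (hc : 0 < c) :
    MeasureTheory.Integrable fun τ : ℝ =>
      1 / (((c : ℂ) + τ * Complex.I) * ((c : ℂ) + τ * Complex.I + 1)) :=
  integrable_of_le_one_add_abs_rpow (continuous_verticalLine_rieszKernel hc) (r := 2)
    (by norm_num) (norm_inv_mul_add_one_le hc)

/-- Truncating a Dirichlet series smoothly amounts to a Mellin–Barnes integral. -/
theorem LSeries_mul_rieszKernel_eq_integral {a : ℕ → ℂ} {y c : ℝ} (hy : 0 < y) (hc : 0 < c) {z : ℂ}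
    (hz : LSeriesSummable a ((z.re - c : ℝ) : ℂ)) :
    LSeries (fun m => a m * (rieszKernel (y / m) : ℂ)) z =
      (1 / (2 * Real.pi) : ℝ) * ∫ τ : ℝ, (y : ℂ) ^ (-((c : ℂ) + τ * Complex.I)) *
        LSeries a (z - ((c : ℂ) + τ * Complex.I)) *
        (1 / (((c : ℂ) + τ * Complex.I) * ((c : ℂ) + τ * Complex.I + 1))) := by
  set ker : ℝ → ℂ := fun τ => 1 / (((c : ℂ) + τ * Complex.I) * ((c : ℂ) + τ * Complex.I + 1))
  set F : ℕ → ℝ → ℂ := fun m τ => (y : ℂ) ^ (-((c : ℂ) + τ * Complex.I)) *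
    LSeries.term a (z - ((c : ℂ) + τ * Complex.I)) m * ker τ
  have hy' : (y : ℂ) ≠ 0 := by exact_mod_cast hy.ne'
  have hterm : ∀ (m : ℕ) (τ : ℝ), ‖LSeries.term a (z - ((c : ℂ) + τ * Complex.I)) m‖ =
      ‖LSeries.term a ((z.re - c : ℝ) : ℂ) m‖ := by
    intro m τ
    rw [LSeries.norm_term_eq, LSeries.norm_term_eq]
    simp
  have hnorm : ∀ m τ, ‖F m τ‖ = y ^ (-c) * ‖LSeries.term a ((z.re - c : ℝ) : ℂ) m‖ * ‖ker τ‖ := by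
    intro m τ
    simp only [F]
    rw [norm_mul, norm_mul, hterm, Complex.norm_cpow_eq_rpow_re_of_pos hy]
    simp
  have hcont : ∀ m, Continuous (F m) := by
    intro m
    refine Continuous.mul (Continuous.mul ?_ ?_) (continuous_verticalLine_rieszKernel hc)
    · exact Continuous.const_cpow (by fun_prop) (Or.inl hy')
    · rcases eq_or_ne m 0 with rfl | hm
      · simp only [LSeries.term_zero]; exact continuous_const
      · simp only [LSeries.term_of_ne_zero hm]
        have hm' : (m : ℂ) ≠ 0 := by exact_mod_cast hm
        refine continuous_const.div (Continuous.const_cpow (by fun_prop) (Or.inl hm')) fun τ => ?_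
        simp [hm']
  have hker := integrable_verticalLine_rieszKernel hc
  have hInt : ∀ m, MeasureTheory.Integrable (F m) := fun m =>
    (hker.norm.const_mul (y ^ (-c) * ‖LSeries.term a ((z.re - c : ℝ) : ℂ) m‖)).mono'
      (hcont m).aestronglyMeasurable (Eventually.of_forall fun τ => (hnorm m τ).le)
  have hsum : Summable fun m => ∫ τ, ‖F m τ‖ := by
    simp_rw [hnorm, MeasureTheory.integral_const_mul]
    exact (hz.norm.mul_left _).mul_right _
  have H := MeasureTheory.hasSum_integral_of_summable_integral_norm hInt hsum
  have e1 : ∀ τ, ∑' m, F m τ = (y : ℂ) ^ (-((c : ℂ) + τ * Complex.I)) *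
        LSeries a (z - ((c : ℂ) + τ * Complex.I)) * ker τ := by
    intro τ
    simp only [F]
    rw [tsum_mul_right, tsum_mul_left]
    rfl
  simp_rw [e1] at H
  rw [← H.tsum_eq, ← tsum_mul_left, LSeries]
  congr 1
  ext m
  rcases eq_or_ne m 0 with rfl | hm
  · simp [F]
  · have hm0 : (0 : ℝ) < m := by exact_mod_cast hm.bot_lt
    have hm' : (m : ℂ) ≠ 0 := by exact_mod_cast hm
    rw [LSeries.term_of_ne_zero hm, rieszKernel_eq_integral hc (div_pos hy hm0)]
    rw [mul_left_comm, mul_div_assoc, ← MeasureTheory.integral_const_mul,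
      ← MeasureTheory.integral_div]
    congr 2
    ext τ
    simp only [F, ker, LSeries.term_of_ne_zero hm]
    have e2 : ((y / m : ℝ) : ℂ) ^ (-((c : ℂ) + τ * Complex.I)) =
        (y : ℂ) ^ (-((c : ℂ) + τ * Complex.I)) * (m : ℂ) ^ ((c : ℂ) + τ * Complex.I) := by
      rw [Complex.ofReal_div, div_eq_mul_inv, ← Complex.ofReal_inv,
        Complex.mul_cpow_ofReal_nonneg hy.le (by positivity), Complex.ofReal_inv,
        Complex.inv_cpow, Complex.cpow_neg, Complex.cpow_neg, inv_inv, Complex.ofReal_natCast]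
      rw [Complex.ofReal_natCast, Complex.natCast_arg]
      exact Real.pi_pos.ne
    rw [e2, Complex.cpow_sub _ _ hm']
    field_simp

theorem four_add_abs_sub_le (a b : ℝ) : 4 + |a - b| ≤ (4 + |a|) * (1 + |b|) := by
  have := abs_sub a b
  nlinarith [abs_nonneg a, abs_nonneg b]

/-- Square-root cancellation in smooth tails of the Dirichlet series of `ζ⁻²`, under RH. -/
theorem exists_norm_LSeries_moebiusSq_mul_rieszKernel_le
    (hRH : ∀ ρ : ℂ, riemannZeta ρ = 0 → 0 < ρ.re → ρ.re < 1 → ρ.re = 1 / 2)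
    {X δ η : ℝ} (hδ : 0 < δ) (hX : 1 + 2 * δ ≤ X) (hη : 0 < η) (hη' : η ≤ 1 / 4) :
    ∃ C : ℝ, 0 < C ∧ ∀ y : ℝ, 0 < y → ∀ z : ℂ, z.re = X →
      ‖LSeries (fun m => (moebiusSq m : ℂ) * (rieszKernel (y / m) : ℂ)) z‖ ≤
        C * y ^ (-(X - 1 / 2 - δ)) * (4 + |z.im|) ^ (2 * η) := by
  obtain ⟨D, hD, hW⟩ := exists_norm_zetaInv_le hRH hδ hη
  set c := X - 1 / 2 - δ
  have hc : 1 / 2 ≤ c - δ := by simp only [c]; linarith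
  have hc0 : 0 < c := by linarith
  have hcX : c = X - 1 / 2 - δ := rfl
  set A := D ^ 2 * (2 * (1 + 1 / δ ^ 2))
  have hA : 0 < A := by positivity
  set J := ∫ τ : ℝ, (1 + |τ|) ^ (-(2 - 2 * η))
  have hJ : 0 ≤ J := MeasureTheory.integral_nonneg fun τ => by positivity
  refine ⟨1 / (2 * Real.pi) * (A * (J + 1)), by positivity, fun y hy z hz => ?_⟩
  have hy' : (y : ℂ) ≠ 0 := by exact_mod_cast hy.ne'
  set Φ : ℂ → ℂ := fun w => (y : ℂ) ^ (-w) * zetaInv (z - w) ^ 2 * (1 / (w * (w + 1)))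
  have hker : ∀ w : ℂ, δ ≤ w.re →
      ‖1 / (w * (w + 1))‖ ≤ 2 * (1 + 1 / δ ^ 2) * (1 + |w.im|) ^ (-2 : ℝ) := by
    intro w h1
    have := norm_inv_mul_add_one_le (lt_of_lt_of_le hδ h1) w.im
    rw [Complex.re_add_im] at this
    refine this.trans ?_
    gcongr
  have hΦ : ∀ w : ℂ, δ ≤ w.re → w.re ≤ c →
      ‖Φ w‖ ≤ y ^ (-w.re) * (A * (4 + |z.im|) ^ (2 * η)) * (1 + |w.im|) ^ (-(2 - 2 * η)) := by
    intro w h1 h2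
    have hre : 1 / 2 + δ ≤ (z - w).re := by simp only [Complex.sub_re, hz]; linarith
    have h3 : ‖zetaInv (z - w)‖ ≤ D * ((4 + |z.im|) * (1 + |w.im|)) ^ η := by
      refine (hW _ hre).trans ?_
      gcongr
      simpa using four_add_abs_sub_le z.im w.im
    simp only [Φ]
    rw [norm_mul, norm_mul, norm_pow, Complex.norm_cpow_eq_rpow_re_of_pos hy, Complex.neg_re]
    calc _ ≤ y ^ (-w.re) * (D * ((4 + |z.im|) * (1 + |w.im|)) ^ η) ^ 2 *
          (2 * (1 + 1 / δ ^ 2) * (1 + |w.im|) ^ (-2 : ℝ)) := by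
          gcongr
          exact hker w h1
      _ = _ := by
        have e1 : -(2 - 2 * η) = -2 + η * (2 : ℕ) := by push_cast; ring
        have e2 : (2 * η) = η * (2 : ℕ) := by push_cast; ring
        rw [e1, e2, Real.rpow_add (by positivity), Real.rpow_mul_natCast (by positivity),
          Real.rpow_mul_natCast (by positivity), Real.mul_rpow (by positivity) (by positivity)]
        simp only [A]
        ring
  have hΦd : ∀ w : ℂ, δ ≤ w.re → w.re ≤ c → DifferentiableAt ℂ Φ w := by
    intro w h1 h2
    have hre : 1 / 2 < (z - w).re := by simp only [Complex.sub_re, hz]; linarith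
    have hw0 : w ≠ 0 := by rintro rfl; simp at h1; linarith
    have hw1 : w + 1 ≠ 0 := by
      intro h; have := congrArg Complex.re h; simp at this; linarith
    refine DifferentiableAt.mul (DifferentiableAt.mul ?_ (DifferentiableAt.pow ?_ 2)) ?_
    · exact DifferentiableAt.const_cpow (by fun_prop) (Or.inl hy')
    · exact DifferentiableAt.comp w (g := zetaInv) (f := fun w => z - w)
        (differentiableAt_zetaInv hRH hre) (by fun_prop)
    · exact (differentiableAt_const _).div (by fun_prop) (mul_ne_zero hw0 hw1)
  have hshift : ∫ τ : ℝ, Φ (δ + τ * Complex.I) = ∫ τ : ℝ, Φ (c + τ * Complex.I) := by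
    refine integral_verticalLine_eq (r := 2 - 2 * η)
      (C := max (y ^ (-δ)) (y ^ (-c)) * (A * (4 + |z.im|) ^ (2 * η)))
      (by linarith) (by linarith) hΦd fun w h1 h2 => (hΦ w h1 h2).trans ?_
    gcongr
    rcases le_total y 1 with h | h
    · exact (Real.rpow_le_rpow_of_exponent_ge hy h (by linarith)).trans (le_max_right _ _)
    · exact (Real.rpow_le_rpow_of_exponent_le h (by linarith)).trans (le_max_left _ _)
  have hrep := LSeries_mul_rieszKernel_eq_integral (a := fun m => (moebiusSq m : ℂ)) hy hδ (z := z)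
    (LSeriesSummable_moebiusSq (by rw [Complex.ofReal_re, hz]; linarith))
  have e3 : ∀ τ : ℝ, LSeries (fun m => (moebiusSq m : ℂ)) (z - ((δ : ℂ) + τ * Complex.I)) =
      zetaInv (z - ((δ : ℂ) + τ * Complex.I)) ^ 2 := fun τ =>
    LSeries_moebiusSq (by simp [hz]; linarith)
  simp_rw [e3] at hrep
  change _ = _ * ∫ τ : ℝ, Φ (δ + τ * Complex.I) at hrep
  rw [hrep, hshift, norm_mul, Complex.norm_real, Real.norm_eq_abs, abs_of_pos (by positivity)]
  have hI : MeasureTheory.Integrable fun τ : ℝ => (1 + |τ|) ^ (-(2 - 2 * η)) := by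
    simpa using (integrable_one_add_norm (E := ℝ) (μ := MeasureTheory.volume) (r := 2 - 2 * η)
      (by simp; linarith))
  have hfin : ‖∫ τ : ℝ, Φ (c + τ * Complex.I)‖ ≤ y ^ (-c) * (A * (4 + |z.im|) ^ (2 * η)) * J := by
    rw [← MeasureTheory.integral_const_mul]
    refine MeasureTheory.norm_integral_le_of_norm_le (hI.const_mul _) (Eventually.of_forall fun τ => ?_)
    simpa using hΦ (c + τ * Complex.I) (by simp; linarith) (by simp)
  calc _ ≤ 1 / (2 * Real.pi) * (y ^ (-c) * (A * (4 + |z.im|) ^ (2 * η)) * (J + 1)) := by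
        gcongr
        exact hfin.trans (by gcongr; linarith)
    _ = _ := by ring

/-- `n ↦ a (n^(1/k))`, supported on `k`-th powers: the coefficients of `A(ks)`, where `A` is the
Dirichlet series of `a`. -/
def powDilate (k : ℕ) (a : ArithmeticFunction ℤ) : ArithmeticFunction ℤ where
  toFun n := ∑ m ∈ n.divisors with m ^ k = n, a m
  map_zero' := by simp

theorem powDilate_apply (k : ℕ) (a : ArithmeticFunction ℤ) (n : ℕ) :
    powDilate k a n = ∑ m ∈ n.divisors with m ^ k = n, a m := rfl

theorem powDilate_pow {k : ℕ} (hk : k ≠ 0) (a : ArithmeticFunction ℤ) (m : ℕ) :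
    powDilate k a (m ^ k) = a m := by
  rcases eq_or_ne m 0 with rfl | hm
  · simp [hk]
  rw [powDilate_apply, Finset.sum_eq_single m]
  · intro b hb hne
    exact absurd (Nat.pow_left_injective hk (Finset.mem_filter.1 hb).2) hne
  · intro h
    exact (h (Finset.mem_filter.2
      ⟨Nat.mem_divisors.2 ⟨dvd_pow_self m hk, pow_ne_zero k hm⟩, rfl⟩)).elim

theorem powDilate_eq_zero {k : ℕ} (a : ArithmeticFunction ℤ) {n : ℕ} (hn : ∀ m, m ^ k ≠ n) :
    powDilate k a n = 0 := by
  rw [powDilate_apply, Finset.filter_false_of_mem fun m _ => hn m, Finset.sum_empty]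

theorem isMultiplicative_powDilate {k : ℕ} (hk : k ≠ 0) {a : ArithmeticFunction ℤ}
    (ha : a.IsMultiplicative) : (powDilate k a).IsMultiplicative := by
  refine ⟨?_, fun {m n} hmn => ?_⟩
  · have := powDilate_pow hk a 1
    rwa [one_pow, ha.1] at this
  · by_cases hm : ∃ m', m' ^ k = m
    · by_cases hn : ∃ n', n' ^ k = n
      · obtain ⟨m', rfl⟩ := hm
        obtain ⟨n', rfl⟩ := hn
        rw [← mul_pow, powDilate_pow hk, powDilate_pow hk, powDilate_pow hk]
        refine ha.2 ?_
        rwa [Nat.coprime_pow_left_iff (Nat.pos_of_ne_zero hk),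
          Nat.coprime_pow_right_iff (Nat.pos_of_ne_zero hk)] at hmn
      · rw [powDilate_eq_zero a (not_exists.1 hn), mul_zero]
        refine powDilate_eq_zero a fun c hc => hn ?_
        obtain ⟨d, hd⟩ := exists_eq_pow_of_mul_eq_pow (a := n) (b := m) (c := c) (k := k)
          (Nat.isUnit_iff.2 hmn.symm) (by rw [hc, mul_comm])
        exact ⟨d, hd.symm⟩
    · rw [powDilate_eq_zero a (not_exists.1 hm), zero_mul]
      refine powDilate_eq_zero a fun c hc => hm ?_
      obtain ⟨d, hd⟩ := exists_eq_pow_of_mul_eq_pow (a := m) (b := n) (c := c) (k := k)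
        (Nat.isUnit_iff.2 hmn) hc.symm
      exact ⟨d, hd.symm⟩

theorem sum_powDilate_prime_pow {k : ℕ} (hk : k ≠ 0) (a : ArithmeticFunction ℤ) {p : ℕ}
    (hp : p.Prime) (j : ℕ) :
    ∑ i ∈ Finset.range (j + 1), powDilate k a (p ^ i) =
      ∑ l ∈ Finset.range (j / k + 1), a (p ^ l) := by
  induction j with
  | zero => simpa using powDilate_pow hk a 1
  | succ j ih =>
    rw [Finset.sum_range_succ, ih, Nat.succ_div]
    split_ifs with h
    · obtain ⟨l, hl⟩ := h
      have : j / k + 1 = l := by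
        have := Nat.succ_div (a := j) (b := k)
        rw [if_pos ⟨l, hl⟩, hl, Nat.mul_div_cancel_left _ (Nat.pos_of_ne_zero hk)] at this
        exact this.symm
      rw [Finset.sum_range_succ _ (j / k + 1), this, hl, mul_comm k l, pow_mul, powDilate_pow hk]
    · rw [powDilate_eq_zero, add_zero, add_zero]
      intro m hm
      obtain ⟨l, -, rfl⟩ := (Nat.dvd_prime_pow hp).1 (hm ▸ dvd_pow_self m hk)
      rw [← pow_mul] at hm
      exact h ⟨l, by rw [← Nat.pow_right_injective hp.two_le hm, mul_comm]⟩

theorem zeta_mul_powDilate_moebiusSq_prime_pow {k : ℕ} (hk : k ≠ 0) {p : ℕ} (hp : p.Prime) (j : ℕ) :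
    (powDilate k moebiusSq * (ArithmeticFunction.zeta : ArithmeticFunction ℤ)) (p ^ j) =
      ArithmeticFunction.moebius (p ^ (j / k)) := by
  rw [ArithmeticFunction.coe_mul_zeta_apply, Nat.sum_divisors_prime_pow hp,
    sum_powDilate_prime_pow hk moebiusSq hp, ← Nat.sum_divisors_prime_pow hp,
    ← ArithmeticFunction.coe_zeta_mul_apply, moebiusSq, ← mul_assoc,
    ArithmeticFunction.coe_zeta_mul_moebius, one_mul]

theorem sum_Ioc_powDilate_mul {k : ℕ} (hk : k ≠ 0) (a : ArithmeticFunction ℤ) (N : ℕ) :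
    ∑ d ∈ Finset.Ioc 0 N, powDilate k a d * ((N / d : ℕ) : ℤ) =
      ∑ m ∈ Finset.Ioc 0 N, a m * ((N / m ^ k : ℕ) : ℤ) := by
  have h1 : ∀ d ∈ Finset.Ioc 0 N, powDilate k a d * ((N / d : ℕ) : ℤ) =
      ∑ m ∈ Finset.Ioc 0 N, if m ^ k = d then a m * ((N / d : ℕ) : ℤ) else 0 := by
    intro d hd
    rw [Finset.mem_Ioc] at hd
    rw [powDilate_apply, Finset.sum_mul, ← Finset.sum_filter]
    refine Finset.sum_congr (Finset.ext fun m => ?_) fun _ _ => rfl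
    simp only [Finset.mem_filter, Nat.mem_divisors, Finset.mem_Ioc]
    refine and_congr_left fun h => ?_
    constructor
    · rintro ⟨h2, h3⟩
      exact ⟨Nat.pos_of_dvd_of_pos h2 hd.1, (Nat.le_of_dvd hd.1 h2).trans hd.2⟩
    · rintro -
      exact ⟨h ▸ dvd_pow_self m hk, hd.1.ne'⟩
  rw [Finset.sum_congr rfl h1, Finset.sum_comm]
  refine Finset.sum_congr rfl fun m hm => ?_
  rw [Finset.mem_Ioc] at hm
  rw [Finset.sum_ite_eq, ]
  split_ifs with h
  · rfl
  · have : N < m ^ k := by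
      by_contra h2
      exact h (Finset.mem_Ioc.2 ⟨pow_pos hm.1 k, not_lt.1 h2⟩)
    rw [Nat.div_eq_of_lt this]
    simp

/-- The coefficients of `ζ(s)/ζ(ks)²`. -/
structure IsFakeMoebius (k : ℕ) (g : ℕ → ℤ) : Prop where
  one : g 1 = 1
  mul : ∀ m n : ℕ, Nat.Coprime m n → g (m * n) = g m * g n
  lt : ∀ p : ℕ, Nat.Prime p → ∀ j : ℕ, 1 ≤ j → j ≤ k - 1 → g (p ^ j) = 1
  mid : ∀ p : ℕ, Nat.Prime p → ∀ j : ℕ, k ≤ j → j ≤ 2 * k - 1 → g (p ^ j) = -1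
  ge : ∀ p : ℕ, Nat.Prime p → ∀ j : ℕ, 2 * k ≤ j → g (p ^ j) = 0

namespace IsFakeMoebius

variable {k : ℕ} {g : ℕ → ℤ}

theorem prime_pow (hg : IsFakeMoebius k g) (hk : k ≠ 0) {p : ℕ} (hp : p.Prime) (j : ℕ) :
    g (p ^ j) = ArithmeticFunction.moebius (p ^ (j / k)) := by
  have hk0 : 0 < k := Nat.pos_of_ne_zero hk
  rcases lt_or_ge j k with h | h
  · rw [Nat.div_eq_of_lt h, pow_zero, ArithmeticFunction.moebius_apply_one]
    rcases Nat.eq_zero_or_pos j with rfl | hj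
    · simpa using hg.one
    · exact hg.lt p hp j hj (by omega)
  rcases lt_or_ge j (2 * k) with h2 | h2
  · have : j / k = 1 := Nat.div_eq_of_lt_le (by omega) (by omega)
    rw [this, pow_one, ArithmeticFunction.moebius_apply_prime hp]
    exact hg.mid p hp j h (by omega)
  · have : 2 ≤ j / k := (Nat.le_div_iff_mul_le hk0).2 h2
    rw [ArithmeticFunction.moebius_apply_prime_pow hp (by omega), if_neg (by omega)]
    exact hg.ge p hp j h2

theorem eq_apply (hg : IsFakeMoebius k g) (hk : k ≠ 0) {n : ℕ} (hn : n ≠ 0) :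
    g n = (powDilate k moebiusSq * (ArithmeticFunction.zeta : ArithmeticFunction ℤ)) n := by
  set G : ArithmeticFunction ℤ := ⟨fun n => if n = 0 then 0 else g n, by simp⟩
  have hG : ∀ n, n ≠ 0 → G n = g n := fun n hn => if_neg hn
  have hGm : G.IsMultiplicative := by
    rw [ArithmeticFunction.IsMultiplicative.iff_ne_zero]
    refine ⟨by rw [hG 1 one_ne_zero, hg.one], fun {m n} hm hn hmn => ?_⟩
    rw [hG _ (mul_ne_zero hm hn), hG _ hm, hG _ hn, hg.mul m n hmn]
  have hb : (powDilate k moebiusSq * (ArithmeticFunction.zeta : ArithmeticFunction ℤ)).IsMultiplicative :=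
    (isMultiplicative_powDilate hk (ArithmeticFunction.isMultiplicative_moebius.mul
      ArithmeticFunction.isMultiplicative_moebius)).mul
      ArithmeticFunction.isMultiplicative_zeta.natCast
  rw [← hG n hn]
  congr 1
  rw [ArithmeticFunction.IsMultiplicative.eq_iff_eq_on_prime_powers G hGm _ hb]
  intro p i hp
  rw [hG _ (pow_ne_zero i hp.ne_zero), hg.prime_pow hk hp,
    zeta_mul_powDilate_moebiusSq_prime_pow hk hp]

theorem abs_le_one (hg : IsFakeMoebius k g) (hk : k ≠ 0) (n : ℕ) (hn : n ≠ 0) : |g n| ≤ 1 := by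
  induction n using Nat.recOnPosPrimePosCoprime with
  | prime_pow p n hp _ =>
    rw [hg.prime_pow hk hp]
    exact ArithmeticFunction.abs_moebius_le_one
  | zero => exact absurd rfl hn
  | one => simp [hg.one]
  | coprime a b ha hb hab iha ihb =>
    rw [hg.mul a b hab, abs_mul]
    exact mul_le_one₀ (iha (by omega)) (abs_nonneg _) (ihb (by omega))

theorem sum_Icc (hg : IsFakeMoebius k g) (hk : k ≠ 0) (N : ℕ) :
    ∑ n ∈ Finset.Icc 1 N, g n = ∑ m ∈ Finset.Ioc 0 N, moebiusSq m * ((N / m ^ k : ℕ) : ℤ) := by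
  rw [← sum_Ioc_powDilate_mul hk, ← Finset.Icc_add_one_left_eq_Ioc, zero_add,
    Finset.sum_congr rfl fun n hn => hg.eq_apply hk (Nat.one_le_iff_ne_zero.1 (Finset.mem_Icc.1 hn).1)]
  have := ArithmeticFunction.sum_Ioc_mul_zeta_eq_sum (powDilate k moebiusSq) N
  rw [← Finset.Icc_add_one_left_eq_Ioc, zero_add] at this
  exact_mod_cast this

theorem hasSum_floor (hg : IsFakeMoebius k g) (hk : k ≠ 0) (u : ℝ) :
    HasSum (fun m : ℕ => (moebiusSq m : ℝ) * (⌊u / (m : ℝ) ^ k⌋₊ : ℝ))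
      (∑ n ∈ Finset.Icc 1 ⌊u⌋₊, (g n : ℝ)) := by
  have e : ∀ m : ℕ, ⌊u / (m : ℝ) ^ k⌋₊ = ⌊u⌋₊ / m ^ k := fun m => by
    rw [← Nat.floor_div_natCast]; push_cast; rfl
  have h1 : (∑ n ∈ Finset.Icc 1 ⌊u⌋₊, (g n : ℝ)) =
      ∑ m ∈ Finset.Ioc 0 ⌊u⌋₊, (moebiusSq m : ℝ) * (⌊u / (m : ℝ) ^ k⌋₊ : ℝ) := by
    have := congrArg (fun z : ℤ => (z : ℝ)) (hg.sum_Icc hk ⌊u⌋₊)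
    simp only [Int.cast_sum, Int.cast_mul, Int.cast_natCast] at this
    simp_rw [e, this]
  rw [h1]
  refine hasSum_sum_of_ne_finset_zero fun m hm => ?_
  rw [e]
  rcases Nat.eq_zero_or_pos m with rfl | hm0
  · simp
  · have : ⌊u⌋₊ < m := by
      by_contra h
      exact hm (Finset.mem_Ioc.2 ⟨hm0, not_lt.1 h⟩)
    rw [Nat.div_eq_of_lt (this.trans_le (Nat.le_self_pow hk m))]
    simp

end IsFakeMoebius

theorem hasSum_moebiusSq_div_pow {k : ℕ} (hk : 2 ≤ k) :
    HasSum (fun m : ℕ => (moebiusSq m : ℝ) / (m : ℝ) ^ k) (1 / (∑' n : ℕ, ((n : ℝ) ^ k)⁻¹) ^ 2) := by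
  have hk1 : 1 < ((k : ℂ)).re := by simp; omega
  have hkne : (k : ℂ) ≠ 1 := by
    intro h; rw [h] at hk1; simp at hk1
  have h := (LSeriesSummable_moebiusSq hk1).LSeriesHasSum
  rw [LSeriesHasSum, LSeries_moebiusSq hk1, zetaInv_eq hkne,
    zeta_nat_eq_tsum_of_gt_one (by omega)] at h
  rw [← Complex.hasSum_ofReal]
  convert h using 1
  · ext m
    rcases eq_or_ne m 0 with rfl | hm
    · simp
    · rw [LSeries.term_of_ne_zero hm]
      push_cast
      rw [Complex.cpow_natCast]
  · push_cast
    rw [one_div, inv_pow]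
    simp only [one_div]

/-- The error term as a series of sawtooth functions. -/
theorem IsFakeMoebius.hasSum_error {k : ℕ} {g : ℕ → ℤ} (hg : IsFakeMoebius k g) (hk : 2 ≤ k)
    (u : ℝ) :
    HasSum (fun m : ℕ => (moebiusSq m : ℝ) * ((⌊u / (m : ℝ) ^ k⌋₊ : ℝ) - u / (m : ℝ) ^ k))
      (∑ n ∈ Finset.Icc 1 ⌊u⌋₊, (g n : ℝ) - u / (∑' n : ℕ, ((n : ℝ) ^ k)⁻¹) ^ 2) := by
  have h := (hg.hasSum_floor (by omega) u).sub ((hasSum_moebiusSq_div_pow hk).mul_left u)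
  rw [mul_one_div] at h
  refine h.congr_fun fun m => ?_
  rw [mul_sub, mul_div_left_comm]

theorem continuousAt_sawAverage {t : ℝ} (ht : t ≠ 0) : ContinuousAt sawAverage t := by
  unfold sawAverage
  exact (continuousAt_const.add (continuous_fractBump.continuousAt.div continuousAt_id ht)).div_const _

/-- The Mellin transform of `sawAverage` on a vertical line. -/
noncomputable def sawTransform (σ τ : ℝ) : ℂ :=
  riemannZeta (σ + τ * Complex.I) *
    (1 / (((σ : ℂ) + τ * Complex.I) * ((σ : ℂ) + τ * Complex.I + 1)))

theorem continuous_sawTransform {σ : ℝ} (h0 : 0 < σ) (h1 : σ ≠ 1) : Continuous (sawTransform σ) := by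
  refine Continuous.mul ?_ (continuous_verticalLine_rieszKernel h0)
  rw [continuous_iff_continuousAt]
  intro τ
  refine ContinuousAt.comp (f := fun τ : ℝ => (σ + τ * Complex.I : ℂ))
    (differentiableAt_riemannZeta fun h => h1 ?_).continuousAt (by fun_prop)
  simpa using congrArg Complex.re h

theorem sawAverage_eq_integral {σ t : ℝ} (h0 : 0 < σ) (h1 : σ < 1)
    (hInt : MeasureTheory.Integrable (sawTransform σ)) (ht : 0 < t) :
    (sawAverage t : ℂ) =
      (1 / (2 * Real.pi) : ℝ) * ∫ τ : ℝ, (t : ℂ) ^ ((σ : ℂ) + τ * Complex.I) * sawTransform σ τ := by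
  have hm : ∀ τ : ℝ, HasMellin (fun t => (sawAverage t : ℂ)) (((-σ : ℝ) : ℂ) + τ * Complex.I)
      (sawTransform σ (-τ)) := by
    intro τ
    have := hasMellin_sawAverage (s := (σ : ℂ) + ((-τ : ℝ) : ℂ) * Complex.I) (by simpa) (by simpa)
    convert this using 1
    · push_cast; ring
    · rfl
  have hinv := mellinInv_mellin_eq (-σ) (fun t => (sawAverage t : ℂ)) ht
    (by simpa using (hm 0).1)
    (by
      refine (hInt.comp_neg).congr (Eventually.of_forall fun τ => ?_)
      exact (hm τ).2.symm)
    (Complex.continuous_ofReal.continuousAt.comp (continuousAt_sawAverage ht.ne'))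
  rw [← hinv, mellinInv, ← MeasureTheory.integral_neg_eq_self, ← Complex.real_smul]
  congr 1
  congr 1
  ext τ
  rw [(hm (-τ)).2, smul_eq_mul, neg_neg]
  congr 2
  push_cast; ring

theorem exists_norm_sawTransform_le
    (hRH : ∀ ρ : ℂ, riemannZeta ρ = 0 → 0 < ρ.re → ρ.re < 1 → ρ.re = 1 / 2) {δ η : ℝ}
    (hδ : 0 < δ) (hδ' : δ < 1 / 4) (hη : 0 < η) :
    ∃ C : ℝ, 0 < C ∧ ∀ τ : ℝ, ‖sawTransform (1 / 2 + δ) τ‖ ≤ C * (1 + |τ|) ^ (η - 2) := by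
  obtain ⟨D, hD, hz⟩ := exists_norm_riemannZeta_le_rpow hRH hδ hδ' hη
  have hσ : 0 < 1 / 2 + δ := by linarith
  refine ⟨D * 4 ^ η * (2 * (1 + 1 / (1 / 2 + δ) ^ 2)), by positivity, fun τ => ?_⟩
  rw [sawTransform, norm_mul]
  calc _ ≤ D * (4 * (1 + |τ|)) ^ η * (2 * (1 + 1 / (1 / 2 + δ) ^ 2) * (1 + |τ|) ^ (-2 : ℝ)) := by
        gcongr
        · refine (hz _ (by simp)).trans ?_
          gcongr
          simp only [Complex.add_im, Complex.ofReal_im, Complex.mul_im, Complex.ofReal_re,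
            Complex.I_im, Complex.I_re]
          simp only [mul_one, mul_zero, add_zero, zero_add]
          linarith [abs_nonneg τ]
        · exact norm_inv_mul_add_one_le hσ τ
    _ = _ := by
        rw [sub_eq_add_neg, Real.rpow_add (by positivity), Real.mul_rpow (by positivity) (by positivity)]
        ring

/-- Summing `sawAverage` against coefficients supported at `k`-th powers. -/
theorem hasSum_mul_sawAverage {σ u : ℝ} {k : ℕ} {b : ℕ → ℂ} (hb0 : b 0 = 0) (h0 : 0 < σ) (h1 : σ < 1)
    (hInt : MeasureTheory.Integrable (sawTransform σ)) (hu : 0 < u)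
    (hb : LSeriesSummable b ((k * σ : ℝ) : ℂ)) :
    HasSum (fun m : ℕ => b m * (sawAverage (u / (m : ℝ) ^ k) : ℂ))
      ((1 / (2 * Real.pi) : ℝ) * ∫ τ : ℝ, (u : ℂ) ^ ((σ : ℂ) + τ * Complex.I) *
        LSeries b (k * ((σ : ℂ) + τ * Complex.I)) * sawTransform σ τ) := by
  set F : ℕ → ℝ → ℂ := fun m τ => (u : ℂ) ^ ((σ : ℂ) + τ * Complex.I) *
    LSeries.term b (k * ((σ : ℂ) + τ * Complex.I)) m * sawTransform σ τ
  have hu' : (u : ℂ) ≠ 0 := by exact_mod_cast hu.ne'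
  have hterm : ∀ (m : ℕ) (τ : ℝ), ‖LSeries.term b (k * ((σ : ℂ) + τ * Complex.I)) m‖ =
      ‖LSeries.term b ((k * σ : ℝ) : ℂ) m‖ := by
    intro m τ
    rw [LSeries.norm_term_eq, LSeries.norm_term_eq]
    simp
  have hnorm : ∀ m τ, ‖F m τ‖ =
      u ^ σ * ‖LSeries.term b ((k * σ : ℝ) : ℂ) m‖ * ‖sawTransform σ τ‖ := by
    intro m τ
    simp only [F]
    rw [norm_mul, norm_mul, hterm, Complex.norm_cpow_eq_rpow_re_of_pos hu]
    simp
  have hcont : ∀ m, Continuous (F m) := by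
    intro m
    refine Continuous.mul (Continuous.mul ?_ ?_) (continuous_sawTransform h0 h1.ne)
    · exact Continuous.const_cpow (by fun_prop) (Or.inl hu')
    · rcases eq_or_ne m 0 with rfl | hm
      · simp only [LSeries.term_zero]; exact continuous_const
      · simp only [LSeries.term_of_ne_zero hm]
        have hm' : (m : ℂ) ≠ 0 := by exact_mod_cast hm
        refine continuous_const.div (Continuous.const_cpow (by fun_prop) (Or.inl hm')) fun τ => ?_
        simp [hm']
  have hFint : ∀ m, MeasureTheory.Integrable (F m) := fun m =>
    (hInt.norm.const_mul (u ^ σ * ‖LSeries.term b ((k * σ : ℝ) : ℂ) m‖)).mono'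
      (hcont m).aestronglyMeasurable (Eventually.of_forall fun τ => (hnorm m τ).le)
  have hsum : Summable fun m => ∫ τ, ‖F m τ‖ := by
    simp_rw [hnorm, MeasureTheory.integral_const_mul]
    exact (hb.norm.mul_left _).mul_right _
  have H := MeasureTheory.hasSum_integral_of_summable_integral_norm hFint hsum
  have e1 : ∀ τ, ∑' m, F m τ = (u : ℂ) ^ ((σ : ℂ) + τ * Complex.I) *
        LSeries b (k * ((σ : ℂ) + τ * Complex.I)) * sawTransform σ τ := by
    intro τ
    simp only [F]
    rw [tsum_mul_right, tsum_mul_left]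
    rfl
  simp_rw [e1] at H
  refine (H.mul_left ((1 / (2 * Real.pi) : ℝ) : ℂ)).congr_fun fun m => ?_
  rcases eq_or_ne m 0 with rfl | hm
  · simp [F, hb0]
  · have hm0 : (0 : ℝ) < m := by exact_mod_cast hm.bot_lt
    rw [sawAverage_eq_integral h0 h1 hInt (by positivity), mul_left_comm,
      ← MeasureTheory.integral_const_mul]
    congr 2
    ext τ
    simp only [F, LSeries.term_of_ne_zero hm]
    have e2 : ((u / (m : ℝ) ^ k : ℝ) : ℂ) ^ ((σ : ℂ) + τ * Complex.I) =
        (u : ℂ) ^ ((σ : ℂ) + τ * Complex.I) / (m : ℂ) ^ (k * ((σ : ℂ) + τ * Complex.I)) := by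
      rw [Complex.ofReal_div, Complex.div_cpow_ofReal_nonneg hu.le (by positivity),
        Complex.ofReal_pow, Complex.ofReal_natCast, ← Complex.natCast_cpow_natCast_mul]
    rw [e2]
    field_simp

theorem norm_cpow_add_one_sub_le {x h : ℝ} (hx : 0 < x) (hh : 0 ≤ h) {s : ℂ} (hs : 0 ≤ s.re) :
    ‖((x + h : ℝ) : ℂ) ^ (s + 1) - (x : ℂ) ^ (s + 1)‖ ≤ ‖s + 1‖ * (x + h) ^ s.re * h := by
  have hs1 : s + 1 ≠ 0 := by
    intro h; have := congrArg Complex.re h; simp at this; linarith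
  have hd : ∀ u ∈ Set.Icc x (x + h), HasDerivWithinAt (fun u : ℝ => (u : ℂ) ^ (s + 1))
      ((s + 1) * (u : ℂ) ^ s) (Set.Icc x (x + h)) u := by
    intro u hu
    have := hasDerivAt_ofReal_cpow_const (x := u) (by linarith [hu.1]) hs1
    rw [add_sub_cancel_right] at this
    exact this.hasDerivWithinAt
  have := Convex.norm_image_sub_le_of_norm_hasDerivWithin_le (C := ‖s + 1‖ * (x + h) ^ s.re) hd
    (fun u hu => ?_) (convex_Icc _ _) (Set.left_mem_Icc.2 (by linarith))
    (Set.right_mem_Icc.2 (by linarith))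
  · simpa [abs_of_nonneg hh] using this
  · have hu0 : 0 < u := hx.trans_le hu.1
    rw [norm_mul, Complex.norm_cpow_eq_rpow_re_of_pos hu0]
    gcongr
    exact hu.2

theorem norm_cpow_add_one_sub_le' {x h δ : ℝ} (hx : 0 < x) (hh : 0 ≤ h) (hδ : 0 ≤ δ) (hδ' : δ ≤ 1)
    {s : ℂ} (hs : 0 ≤ s.re) (hs1 : s.re ≤ 1) :
    ‖((x + h : ℝ) : ℂ) ^ (s + 1) - (x : ℂ) ^ (s + 1)‖ ≤
      4 * (1 + |s.im|) ^ (1 - δ) * h ^ (1 - δ) * (x + h) ^ (s.re + δ) := by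
  have hxh : 0 < x + h := by linarith
  set N := ‖((x + h : ℝ) : ℂ) ^ (s + 1) - (x : ℂ) ^ (s + 1)‖
  have h1 : N ≤ 2 * (1 + |s.im|) * (x + h) ^ s.re * h := by
    refine (norm_cpow_add_one_sub_le hx hh hs).trans ?_
    gcongr
    refine (norm_add_le _ _).trans ?_
    have := Complex.norm_le_abs_re_add_abs_im s
    rw [abs_of_nonneg hs] at this
    rw [norm_one]
    linarith [abs_nonneg s.im]
  have h2 : N ≤ 2 * (x + h) ^ (s.re + 1) := by
    refine (norm_sub_le _ _).trans ?_
    rw [Complex.norm_cpow_eq_rpow_re_of_pos hxh, Complex.norm_cpow_eq_rpow_re_of_pos hx,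
      Complex.add_re, Complex.one_re, two_mul]
    gcongr
    linarith
  have hN : 0 ≤ N := norm_nonneg _
  calc N = N ^ (1 - δ) * N ^ δ := by
        rw [← Real.rpow_add_of_nonneg hN (by linarith) hδ]; simp
    _ ≤ (2 * (1 + |s.im|) * (x + h) ^ s.re * h) ^ (1 - δ) * (2 * (x + h) ^ (s.re + 1)) ^ δ := by
        gcongr
    _ = 2 * (1 + |s.im|) ^ (1 - δ) * h ^ (1 - δ) * (x + h) ^ (s.re + δ) := by
        rw [Real.mul_rpow (by positivity) hh, Real.mul_rpow (by positivity) (by positivity),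
          Real.mul_rpow (by positivity) (by positivity), Real.mul_rpow (by positivity) (by positivity),
          ← Real.rpow_mul hxh.le, ← Real.rpow_mul hxh.le]
        have e1 : (x + h) ^ (s.re + δ) = (x + h) ^ (s.re * (1 - δ)) * (x + h) ^ ((s.re + 1) * δ) := by
          rw [← Real.rpow_add hxh]; ring_nf
        have e2 : (2 : ℝ) = 2 ^ (1 - δ) * 2 ^ δ := by
          rw [← Real.rpow_add two_pos]; simp
        rw [e1]
        conv_rhs => rw [e2]
        ring
    _ ≤ _ := by
        gcongr
        norm_num

/-- Under RH, the smoothly truncated sum of `moebiusSq m` against increments of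
`u ↦ u * sawAverage (u / m ^ k)` is small in short intervals. -/
theorem exists_tsum_sawAverage_increment_le
    (hRH : ∀ ρ : ℂ, riemannZeta ρ = 0 → 0 < ρ.re → ρ.re < 1 → ρ.re = 1 / 2)
    {k : ℕ} (hk : 2 ≤ k) {δ : ℝ} (hδ : 0 < δ) (hδ' : δ < 1 / 4) :
    ∃ C : ℝ, 0 < C ∧ ∀ x h y : ℝ, 0 < x → 0 < h → 0 < y → ∃ S : ℝ,
      HasSum (fun m : ℕ => (moebiusSq m : ℝ) * rieszKernel (y / m) *
        ((x + h) * sawAverage ((x + h) / (m : ℝ) ^ k) - x * sawAverage (x / (m : ℝ) ^ k))) S ∧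
      |S| ≤ C * h ^ (1 - δ) * (x + h) ^ (1 / 2 + 2 * δ) *
        y ^ (-(k * (1 / 2 + δ) - 1 / 2 - δ)) := by
  have hk' : (2 : ℝ) ≤ k := by exact_mod_cast hk
  set σ := 1 / 2 + δ with hσ
  set η := δ / 6
  have hη : 0 < η := by positivity
  have hσ0 : 0 < σ := by positivity
  have hσ1 : σ < 1 := by linarith
  have hX : 1 + 2 * δ ≤ k * σ := by nlinarith
  obtain ⟨C₁, hC₁, H₁⟩ := exists_norm_sawTransform_le hRH hδ hδ' hη
  obtain ⟨C₂, hC₂, H₂⟩ := exists_norm_LSeries_moebiusSq_mul_rieszKernel_le hRH hδ hX hη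
    (by simp only [η]; linarith)
  have hInt : MeasureTheory.Integrable (sawTransform σ) :=
    integrable_of_le_one_add_abs_rpow (continuous_sawTransform hσ0 hσ1.ne) (C := C₁) (r := 2 - η)
      (by simp only [η]; linarith) fun τ => by rw [neg_sub]; exact H₁ τ
  have hI : MeasureTheory.Integrable fun τ : ℝ => (1 + |τ|) ^ (-(1 + δ / 2)) := by
    simpa using (integrable_one_add_norm (E := ℝ) (μ := MeasureTheory.volume) (r := 1 + δ / 2)
      (by simp; linarith))
  set J := ∫ τ : ℝ, (1 + |τ|) ^ (-(1 + δ / 2))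
  have hJ : 0 ≤ J := MeasureTheory.integral_nonneg fun τ => by positivity
  set A := 4 * C₁ * C₂ * (4 * k) ^ (2 * η)
  have hA : 0 < A := by positivity
  refine ⟨1 / (2 * Real.pi) * (A * (J + 1)), by positivity, fun x h y hx hh hy => ?_⟩
  set b : ℕ → ℂ := fun m => (moebiusSq m : ℂ) * (rieszKernel (y / m) : ℂ)
  have hb0 : b 0 = 0 := by simp [b]
  have hb : ∀ z : ℂ, 1 < z.re → LSeriesSummable b z := by
    intro z hz
    refine (LSeriesSummable_moebiusSq hz).norm.of_norm_bounded fun m => ?_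
    rw [LSeries.norm_term_eq, LSeries.norm_term_eq]
    split_ifs with hm
    · rfl
    · gcongr
      simp only [b]
      rw [norm_mul, Complex.norm_real, Real.norm_eq_abs, abs_of_nonneg (rieszKernel_nonneg _)]
      refine mul_le_of_le_one_right (norm_nonneg _) ?_
      have : 0 ≤ y / m := by positivity
      exact max_le zero_le_one (by linarith)
  set G : ℝ → ℝ → ℂ := fun u τ => (u : ℂ) ^ ((σ : ℂ) + τ * Complex.I) *
    LSeries b (k * ((σ : ℂ) + τ * Complex.I)) * sawTransform σ τ
  have hxh : 0 < x + h := by linarith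
  have hb' := hb ((k * σ : ℝ) : ℂ) (by rw [Complex.ofReal_re]; linarith)
  have hs := ((hasSum_mul_sawAverage hb0 hσ0 hσ1 hInt hxh hb').mul_left ((x + h : ℝ) : ℂ)).sub
    ((hasSum_mul_sawAverage hb0 hσ0 hσ1 hInt hx hb').mul_left (x : ℂ))
  set S := ((x + h : ℝ) : ℂ) * ((1 / (2 * Real.pi) : ℝ) * ∫ τ, G (x + h) τ) -
    (x : ℂ) * ((1 / (2 * Real.pi) : ℝ) * ∫ τ, G x τ)
  refine ⟨S.re, ?_, (Complex.abs_re_le_norm S).trans ?_⟩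
  · refine (Complex.reCLM.hasSum hs).congr_fun fun m => ?_
    simp only [Complex.reCLM_apply, b]
    rw [← Complex.ofReal_re (_ * _ * _)]
    push_cast
    ring_nf
  have hGm : ∀ τ : ℝ, ‖LSeries b (k * ((σ : ℂ) + τ * Complex.I)) * sawTransform σ τ‖ ≤
      C₂ * y ^ (-(k * σ - 1 / 2 - δ)) * (4 * k * (1 + |τ|)) ^ (2 * η) *
        (C₁ * (1 + |τ|) ^ (η - 2)) := by
    intro τ
    rw [norm_mul]
    gcongr
    · refine (H₂ y hy _ (by simp)).trans ?_
      gcongr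
      have : |((k : ℂ) * ((σ : ℂ) + τ * Complex.I)).im| = k * |τ| := by simp [abs_mul]
      rw [this]
      nlinarith [abs_nonneg τ]
    · exact H₁ τ
  have hLc : ∀ u, 0 < u → MeasureTheory.Integrable (G u) := by
    intro u hu
    have hu' : (u : ℂ) ≠ 0 := by exact_mod_cast hu.ne'
    have hLd : ∀ z : ℂ, k * σ = z.re → DifferentiableAt ℂ (LSeries b) z := by
      intro z hz
      refine (LSeries_hasDerivAt ?_).differentiableAt
      refine (hb ((1 + δ : ℝ) : ℂ) (by simpa)).abscissaOfAbsConv_le.trans_lt ?_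
      rw [Complex.ofReal_re, ← hz]
      exact_mod_cast (by linarith)
    have hcont : Continuous (G u) := by
      refine ((Continuous.const_cpow (by fun_prop) (Or.inl hu')).mul ?_).mul
        (continuous_sawTransform hσ0 hσ1.ne)
      rw [continuous_iff_continuousAt]
      intro τ
      exact ContinuousAt.comp (f := fun τ : ℝ => (k * (σ + τ * Complex.I) : ℂ))
        (hLd _ (by simp)).continuousAt (by fun_prop)
    refine integrable_of_le_one_add_abs_rpow hcont (r := 2 - 3 * η) (C := u ^ σ *
      (C₂ * y ^ (-(k * σ - 1 / 2 - δ)) * (4 * k) ^ (2 * η) * C₁)) (by simp only [η]; linarith)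
      fun τ => ?_
    simp only [G]
    rw [mul_assoc, norm_mul, Complex.norm_cpow_eq_rpow_re_of_pos hu]
    have hre : ((σ : ℂ) + τ * Complex.I).re = σ := by simp
    rw [hre]
    refine (mul_le_mul_of_nonneg_left (hGm τ) (by positivity)).trans_eq ?_
    rw [show -(2 - 3 * η) = 2 * η + (η - 2) by ring,
      Real.rpow_add (show 0 < 1 + |τ| by positivity),
      Real.mul_rpow (by positivity) (by positivity)]
    ring
  have hS : S = (1 / (2 * Real.pi) : ℝ) * ∫ τ, (((x + h : ℝ) : ℂ) * G (x + h) τ - (x : ℂ) * G x τ) := by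
    rw [MeasureTheory.integral_sub ((hLc _ hxh).const_mul _) ((hLc _ hx).const_mul _),
      MeasureTheory.integral_const_mul, MeasureTheory.integral_const_mul]
    simp only [S]
    ring
  have hpt : ∀ τ, ‖((x + h : ℝ) : ℂ) * G (x + h) τ - (x : ℂ) * G x τ‖ ≤
      A * h ^ (1 - δ) * (x + h) ^ (1 / 2 + 2 * δ) * y ^ (-(k * σ - 1 / 2 - δ)) *
        (1 + |τ|) ^ (-(1 + δ / 2)) := by
    intro τ
    set s : ℂ := (σ : ℂ) + τ * Complex.I
    have hx' : (x : ℂ) ≠ 0 := by exact_mod_cast hx.ne'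
    have hxh' : ((x + h : ℝ) : ℂ) ≠ 0 := by exact_mod_cast hxh.ne'
    have e : ((x + h : ℝ) : ℂ) * G (x + h) τ - (x : ℂ) * G x τ =
        (((x + h : ℝ) : ℂ) ^ (s + 1) - (x : ℂ) ^ (s + 1)) * (LSeries b (k * s) * sawTransform σ τ) := by
      rw [Complex.cpow_add _ _ hx', Complex.cpow_add _ _ hxh', Complex.cpow_one, Complex.cpow_one]
      simp only [G, s]
      ring
    have hinc := norm_cpow_add_one_sub_le' hx hh.le hδ.le (by linarith : δ ≤ 1) (s := s)
      (by simpa [s] using hσ0.le) (by simpa [s] using hσ1.le)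
    have hre : s.re = σ := by simp [s]
    have him : s.im = τ := by simp [s]
    rw [hre, him] at hinc
    rw [e, norm_mul]
    calc _ ≤ _ := mul_le_mul hinc (hGm τ) (norm_nonneg _) (by positivity)
      _ = _ := by
        have e1 : -(1 + δ / 2) = (1 - δ) + 2 * η + (η - 2) := by simp only [η]; ring
        have e2 : 1 / 2 + 2 * δ = σ + δ := by rw [hσ]; ring
        rw [e1, e2, Real.rpow_add (show 0 < 1 + |τ| by positivity),
          Real.rpow_add (show 0 < 1 + |τ| by positivity),
          Real.mul_rpow (by positivity) (by positivity)]
        simp only [A]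
        ring
  rw [hS, norm_mul, Complex.norm_real, Real.norm_eq_abs, abs_of_pos (by positivity)]
  have := MeasureTheory.norm_integral_le_of_norm_le (hI.const_mul (A * h ^ (1 - δ) *
    (x + h) ^ (1 / 2 + 2 * δ) * y ^ (-(k * σ - 1 / 2 - δ)))) (Eventually.of_forall hpt)
  rw [MeasureTheory.integral_const_mul] at this
  calc _ ≤ 1 / (2 * Real.pi) * (A * h ^ (1 - δ) *
      (x + h) ^ (1 / 2 + 2 * δ) * y ^ (-(k * σ - 1 / 2 - δ)) * (J + 1)) := by
        gcongr
        exact this.trans (by gcongr; linarith)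
    _ = _ := by ring

/-- The (nonpositive) error in approximating `t` by `⌊t⌋₊`. -/
noncomputable def floorError (t : ℝ) : ℝ := (⌊t⌋₊ : ℝ) - t

theorem abs_floorError_le {t : ℝ} (ht : 0 ≤ t) : |floorError t| ≤ t := by
  rw [floorError, abs_sub_comm, abs_of_nonneg (sub_nonneg.2 (Nat.floor_le ht))]
  linarith [Nat.cast_nonneg (α := ℝ) ⌊t⌋₊]

theorem abs_floorError_le_rpow {t δ : ℝ} (ht : 0 ≤ t) (hδ : 0 ≤ δ) (hδ' : δ ≤ 1) :
    |floorError t| ≤ t ^ δ := by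
  rcases le_total t 1 with h | h
  · refine (abs_floorError_le ht).trans ?_
    rcases ht.eq_or_lt with rfl | h0
    · positivity
    · simpa using Real.rpow_le_rpow_of_exponent_ge h0 h hδ'
  · refine le_trans ?_ (Real.one_le_rpow h hδ)
    rw [floorError, abs_le]
    constructor <;> linarith [Nat.floor_le ht, Nat.lt_floor_add_one t]

theorem measurable_floorError : Measurable floorError :=
  (measurable_from_nat.comp Nat.measurable_floor).sub measurable_id

theorem intervalIntegrable_floorError_div (a b : ℝ) {c : ℝ} (hc : 0 ≤ c) :
    IntervalIntegrable (fun u => floorError (u / c)) MeasureTheory.volume a b :=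
  (Monotone.intervalIntegrable fun _ _ h => Nat.cast_le.2 (Nat.floor_mono (by gcongr))).sub
    ((continuous_id.div_const c).intervalIntegrable a b)

theorem hasDerivWithinAt_fractBump {t : ℝ} (ht : 0 ≤ t) :
    HasDerivWithinAt (fun v => (-v + fractBump v) / 2) (floorError t) (Set.Ioi t) t := by
  have hd : HasDerivAt (fun v : ℝ => (-v + ((v - ⌊t⌋) - (v - ⌊t⌋) ^ 2)) / 2)
      (floorError t) t := by
    have h1 := (hasDerivAt_id t).sub_const (⌊t⌋ : ℝ)
    refine (((hasDerivAt_id t).neg.add (h1.sub (h1.pow 2))).div_const 2).congr_deriv ?_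
    rw [floorError, natCast_floor_eq_intCast_floor ht]
    simp only [id, Nat.cast_ofNat]
    ring
  refine hd.hasDerivWithinAt.congr_of_eventuallyEq ?_ ?_
  · filter_upwards [Ioo_mem_nhdsGT (Int.lt_floor_add_one t)] with v hv
    have : ⌊v⌋ = ⌊t⌋ := Int.floor_eq_iff.2 ⟨(Int.floor_le t).trans hv.1.le, hv.2⟩
    simp [fractBump, Int.fract, this]
  · rfl

theorem integral_floorError {a b : ℝ} (ha : 0 < a) (hab : a ≤ b) :
    ∫ u in a..b, floorError u = b * sawAverage b - a * sawAverage a := by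
  have e : ∀ t : ℝ, 0 < t → t * sawAverage t = (-t + fractBump t) / 2 := by
    intro t ht
    rw [sawAverage]
    field_simp
  rw [e b (ha.trans_le hab), e a ha]
  refine intervalIntegral.integral_eq_sub_of_hasDeriv_right
    (f := fun v => (-v + fractBump v) / 2) ?_ (fun u hu => ?_)
    (by simpa using intervalIntegrable_floorError_div a b zero_le_one)
  · exact ((continuous_neg.add continuous_fractBump).div_const 2).continuousOn
  · rw [min_eq_left hab] at hu
    exact hasDerivWithinAt_fractBump (ha.trans hu.1).le

theorem integral_floorError_div {x h c : ℝ} (hx : 0 < x) (hh : 0 ≤ h) (hc : 0 < c) :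
    ∫ u in x..(x + h), floorError (u / c) =
      (x + h) * sawAverage ((x + h) / c) - x * sawAverage (x / c) := by
  rw [intervalIntegral.integral_comp_div _ hc.ne', integral_floorError (by positivity)
    (by gcongr; linarith), smul_eq_mul]
  field_simp

theorem abs_sawAverage_increment_le {x h c δ : ℝ} (hx : 0 < x) (hh : 0 ≤ h) (hc : 0 < c)
    (hδ : 0 ≤ δ) (hδ' : δ ≤ 1) :
    |(x + h) * sawAverage ((x + h) / c) - x * sawAverage (x / c)| ≤ ((x + h) / c) ^ δ * h := by
  rw [← integral_floorError_div hx hh hc]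
  have := intervalIntegral.norm_integral_le_of_norm_le_const (a := x) (b := x + h)
    (f := fun u => floorError (u / c)) (C := ((x + h) / c) ^ δ) fun u hu => ?_
  · simpa [abs_of_nonneg hh] using this
  · rw [Set.uIoc_of_le (by linarith)] at hu
    have hu0 : 0 < u := hx.trans hu.1
    refine (abs_floorError_le_rpow (by positivity) hδ hδ').trans ?_
    gcongr
    exact hu.2

theorem summable_abs_moebiusSq_mul_rpow {r : ℝ} (hr : 1 < r) :
    Summable fun m : ℕ => |(moebiusSq m : ℝ)| * (m : ℝ) ^ (-r) := by
  refine (LSeriesSummable_moebiusSq (s := (r : ℂ)) (by simpa)).norm.congr fun m => ?_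
  rw [LSeries.norm_term_eq]
  split_ifs with hm
  · simp [hm]
  · rw [Real.rpow_neg (by positivity), Complex.norm_intCast, Complex.ofReal_re, div_eq_mul_inv]

namespace IsFakeMoebius

variable {k : ℕ} {g : ℕ → ℤ}

theorem abs_sum_sub_le (hg : IsFakeMoebius k g) (hk : k ≠ 0) {x u : ℝ} (hx : 0 ≤ x) (hxu : x ≤ u) :
    |(∑ n ∈ Finset.Icc 1 ⌊u⌋₊, (g n : ℝ)) - ∑ n ∈ Finset.Icc 1 ⌊x⌋₊, (g n : ℝ)| ≤ u - x + 1 := by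
  have hfl : ⌊x⌋₊ ≤ ⌊u⌋₊ := Nat.floor_mono hxu
  have hsub : Finset.Icc 1 ⌊x⌋₊ ⊆ Finset.Icc 1 ⌊u⌋₊ := Finset.Icc_subset_Icc_right hfl
  rw [← Finset.sum_sdiff hsub, add_sub_cancel_right]
  refine (Finset.abs_sum_le_sum_abs _ _).trans ?_
  refine (Finset.sum_le_card_nsmul _ _ 1 fun n hn => ?_).trans ?_
  · have hn0 : n ≠ 0 := by
      have := (Finset.mem_Icc.1 (Finset.mem_sdiff.1 hn).1).1
      omega
    exact_mod_cast hg.abs_le_one hk n hn0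
  · rw [Finset.card_sdiff_of_subset hsub, Nat.card_Icc, Nat.card_Icc, Nat.add_sub_cancel,
      Nat.add_sub_cancel, nsmul_eq_mul, mul_one, Nat.cast_sub hfl]
    linarith [Nat.floor_le (hx.trans hxu), Nat.lt_floor_add_one x]

/-- Averaging the error term over a short interval. -/
theorem exists_hasSum_average (hg : IsFakeMoebius k g) (hk : 2 ≤ k) {x h : ℝ} (hx : 0 < x)
    (hh : 0 ≤ h) : ∃ T : ℝ,
      HasSum (fun m : ℕ => (moebiusSq m : ℝ) *
        ((x + h) * sawAverage ((x + h) / (m : ℝ) ^ k) - x * sawAverage (x / (m : ℝ) ^ k))) T ∧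
      |T - h * ((∑ n ∈ Finset.Icc 1 ⌊x⌋₊, (g n : ℝ)) - x / (∑' n : ℕ, ((n : ℝ) ^ k)⁻¹) ^ 2)| ≤
        (h + 1 + h / (∑' n : ℕ, ((n : ℝ) ^ k)⁻¹) ^ 2) * h := by
  set Z := ∑' n : ℕ, ((n : ℝ) ^ k)⁻¹
  set E : ℝ → ℝ := fun u => (∑ n ∈ Finset.Icc 1 ⌊u⌋₊, (g n : ℝ)) - u / Z ^ 2
  have hE : ∀ u, HasSum (fun m : ℕ => (moebiusSq m : ℝ) * floorError (u / (m : ℝ) ^ k)) (E u) :=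
    hg.hasSum_error hk
  have hle : x ≤ x + h := by linarith
  have hk1 : (1 : ℝ) < k := by exact_mod_cast hk
  have hdom := intervalIntegral.hasSum_integral_of_dominated_convergence
    (μ := MeasureTheory.volume) (a := x) (b := x + h)
    (F := fun (m : ℕ) u => (moebiusSq m : ℝ) *
      (floorError (u / (m : ℝ) ^ k) - floorError (x / (m : ℝ) ^ k)))
    (f := fun u => E u - E x)
    (fun m _ => 2 * (x + h) * (|(moebiusSq m : ℝ)| * (m : ℝ) ^ (-(k : ℝ)))) (fun m => ?_) (fun m => ?_)
    ?_ ?_ ?_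
  · have h2 := hdom.add ((hE x).mul_left h)
    refine ⟨_, h2.congr_fun fun m => ?_, ?_⟩
    · rcases eq_or_ne m 0 with rfl | hm
      · simp
      have hm0 : 0 < (m : ℝ) ^ k := by positivity
      rw [intervalIntegral.integral_const_mul, intervalIntegral.integral_sub _ (by simp),
        integral_floorError_div hx hh hm0]
      · simp
        ring
      · exact intervalIntegrable_floorError_div x (x + h) hm0.le
    · rw [add_sub_cancel_right]
      have := intervalIntegral.norm_integral_le_of_norm_le_const (a := x) (b := x + h)
        (f := fun u => E u - E x) (C := h + 1 + h / Z ^ 2) fun u hu => ?_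
      · simpa [abs_of_nonneg hh] using this
      · rw [Set.uIoc_of_le hle] at hu
        have h3 := hg.abs_sum_sub_le (by omega) hx.le hu.1.le
        have h4 : |u / Z ^ 2 - x / Z ^ 2| ≤ h / Z ^ 2 := by
          rw [← sub_div, abs_of_nonneg (div_nonneg (by linarith [hu.1]) (sq_nonneg _))]
          gcongr
          linarith [hu.2]
        simp only [E, Real.norm_eq_abs]
        rw [sub_sub_sub_comm]
        refine (abs_sub _ _).trans ?_
        linarith [hu.2]
  · exact (((measurable_floorError.comp (measurable_id.div_const _)).sub_const _).const_mul
      _).aestronglyMeasurable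
  · refine Eventually.of_forall fun u hu => ?_
    rw [Set.uIoc_of_le hle] at hu
    have hu0 : 0 < u := hx.trans hu.1
    rw [norm_mul, Real.norm_eq_abs, Real.norm_eq_abs, mul_left_comm]
    refine mul_le_mul_of_nonneg_left ((abs_sub _ _).trans ?_) (abs_nonneg _)
    rw [Real.rpow_neg (by positivity), Real.rpow_natCast, ← div_eq_mul_inv, two_mul, add_div]
    refine add_le_add ((abs_floorError_le (by positivity)).trans ?_)
      ((abs_floorError_le (by positivity)).trans ?_)
    · gcongr; exact hu.2
    · gcongr
  · exact Eventually.of_forall fun _ _ => (summable_abs_moebiusSq_mul_rpow hk1).mul_left _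
  · simp
  · exact Eventually.of_forall fun u _ => by
      simpa [mul_sub] using (hE u).sub (hE x)

end IsFakeMoebius

theorem one_sub_rieszKernel_le {v : ℝ} : 1 - rieszKernel v ≤ v := by
  linarith [le_max_right 0 (1 - v), show rieszKernel v = max 0 (1 - v) from rfl]

theorem rieszKernel_le_one {v : ℝ} (hv : 0 ≤ v) : rieszKernel v ≤ 1 :=
  max_le zero_le_one (by linarith)

theorem abs_moebiusSq_mul_increment_le {k : ℕ} {x h y δ : ℝ} (hx : 0 < x) (hh : 0 ≤ h) (hy : 0 ≤ y)
    (hδ : 0 ≤ δ) (hδ' : δ ≤ 1) (m : ℕ) :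
    |(moebiusSq m : ℝ) * (1 - rieszKernel (y / m)) *
        ((x + h) * sawAverage ((x + h) / (m : ℝ) ^ k) - x * sawAverage (x / (m : ℝ) ^ k))| ≤
      y * h * (x + h) ^ δ * (|(moebiusSq m : ℝ)| * (m : ℝ) ^ (-(1 + k * δ))) := by
  rcases eq_or_ne m 0 with rfl | hm
  · simp
  have hm0 : (0 : ℝ) < m := by exact_mod_cast hm.bot_lt
  rw [abs_mul, abs_mul, abs_of_nonneg (a := 1 - _) (sub_nonneg.2 (rieszKernel_le_one (by positivity)))]
  calc _ ≤ |(moebiusSq m : ℝ)| * (y / m) * (((x + h) / (m : ℝ) ^ k) ^ δ * h) := by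
        gcongr
        · exact one_sub_rieszKernel_le
        · exact abs_sawAverage_increment_le hx hh (by positivity) hδ hδ'
    _ = _ := by
        rw [Real.div_rpow (by linarith) (by positivity), neg_add, Real.rpow_add hm0, Real.rpow_neg_one,
          Real.rpow_neg hm0.le, Real.rpow_natCast_mul hm0.le]
        ring

theorem IsFakeMoebius.exists_abs_error_le
    (hRH : ∀ ρ : ℂ, riemannZeta ρ = 0 → 0 < ρ.re → ρ.re < 1 → ρ.re = 1 / 2)
    {k : ℕ} {g : ℕ → ℤ} (hg : IsFakeMoebius k g) (hk : 2 ≤ k) {δ : ℝ} (hδ : 0 < δ)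
    (hδ' : δ < 1 / 4) :
    ∃ C : ℝ, ∀ x : ℝ, 1 ≤ x →
      |(∑ n ∈ Finset.Icc 1 ⌊x⌋₊, (g n : ℝ)) - x / (∑' n : ℕ, ((n : ℝ) ^ k)⁻¹) ^ 2| ≤
        C * x ^ (1 / ((k : ℝ) + 1) + 2 * δ) := by
  obtain ⟨C, hC, H⟩ := exists_tsum_sawAverage_increment_le hRH hk hδ hδ'
  set Z := ∑' n : ℕ, ((n : ℝ) ^ k)⁻¹
  have hk' : (2 : ℝ) ≤ k := by exact_mod_cast hk
  have hB := summable_abs_moebiusSq_mul_rpow (r := 1 + k * δ) (by nlinarith)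
  set B := ∑' m : ℕ, |(moebiusSq m : ℝ)| * (m : ℝ) ^ (-(1 + k * δ))
  have hB0 : 0 ≤ B := tsum_nonneg fun m => by positivity
  refine ⟨(2 + 1 / Z ^ 2) + 2 * B + 2 * C, fun x hx => ?_⟩
  have hx0 : 0 < x := by linarith
  set θ := 1 / ((k : ℝ) + 1) with hθ
  have hθ0 : 0 < θ := by positivity
  have hθ1 : θ ≤ 1 := by rw [hθ, div_le_one (by positivity)]; linarith
  set h := x ^ θ with hh
  have h1 : 1 ≤ h := Real.one_le_rpow hx hθ0.le
  have hh0 : 0 < h := by linarith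
  have hhx : h ≤ x := by simpa using Real.rpow_le_rpow_of_exponent_le hx hθ1
  obtain ⟨S, hS, hSb⟩ := H x h h hx0 hh0 hh0
  obtain ⟨T, hT, hTb⟩ := hg.exists_hasSum_average hk hx0 hh0.le
  set E := (∑ n ∈ Finset.Icc 1 ⌊x⌋₊, (g n : ℝ)) - x / Z ^ 2
  have hTS : |T - S| ≤ h * h * (x + h) ^ δ * B := by
    have := (hT.sub hS).tsum_eq
    rw [← this, ← Real.norm_eq_abs]
    refine tsum_of_norm_bounded (hB.hasSum.mul_left _) fun m => ?_
    refine le_of_eq_of_le ?_ (abs_moebiusSq_mul_increment_le hx0 hh0.le hh0.le hδ.le (by linarith) m)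
    rw [Real.norm_eq_abs]
    congr 1
    ring
  have hpow : ∀ p : ℝ, 0 ≤ p → p ≤ 1 → (x + h) ^ p ≤ 2 * x ^ p := by
    intro p hp hp1
    calc (x + h) ^ p ≤ (2 * x) ^ p := by gcongr; linarith
      _ = 2 ^ p * x ^ p := Real.mul_rpow (by norm_num) hx0.le
      _ ≤ 2 ^ (1 : ℝ) * x ^ p := by gcongr; norm_num
      _ = _ := by rw [Real.rpow_one]
  set M := x ^ (θ + 2 * δ) with hM
  have hhM : h ≤ M := Real.rpow_le_rpow_of_exponent_le hx (by linarith)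
  have hhδ : h * x ^ δ ≤ M := by
    rw [hh, ← Real.rpow_add hx0]
    exact Real.rpow_le_rpow_of_exponent_le hx (by linarith)
  have hTS' : |T - S| ≤ 2 * B * M * h := by
    refine hTS.trans ?_
    calc _ ≤ h * h * (2 * x ^ δ) * B := by gcongr; exact hpow δ hδ.le (by linarith)
      _ = 2 * B * (h * x ^ δ) * h := by ring
      _ ≤ _ := by gcongr
  have hS' : |S| ≤ 2 * C * M * h := by
    refine hSb.trans ?_
    have hθk : θ * (k + 1) = 1 := by rw [hθ]; field_simp
    calc _ ≤ C * h ^ (1 - δ) * (2 * x ^ (1 / 2 + 2 * δ)) * h ^ (-(k * (1 / 2 + δ) - 1 / 2 - δ)) := by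
          gcongr; exact hpow _ (by linarith) (by linarith)
      _ = 2 * C * x ^ (θ * (1 - δ) + (1 / 2 + 2 * δ) + θ * (-(k * (1 / 2 + δ) - 1 / 2 - δ))) := by
          rw [hh, ← Real.rpow_mul hx0.le, ← Real.rpow_mul hx0.le, Real.rpow_add hx0 (_ + _),
            Real.rpow_add hx0 (θ * _)]
          ring
      _ ≤ 2 * C * x ^ ((θ + 2 * δ) + θ) := by
          refine mul_le_mul_of_nonneg_left
            (Real.rpow_le_rpow_of_exponent_le hx ?_) (by positivity)
          have : 0 ≤ θ * (k * δ) := by positivity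
          nlinarith
      _ = _ := by rw [Real.rpow_add hx0]; ring
  have hav : (h + 1 + h / Z ^ 2) * h ≤ (2 + 1 / Z ^ 2) * M * h := by
    gcongr
    calc h + 1 + h / Z ^ 2 ≤ h + h + h / Z ^ 2 := by gcongr
      _ = (2 + 1 / Z ^ 2) * h := by ring
      _ ≤ _ := by gcongr
  have htri : |h * E| ≤ |T - h * E| + |T - S| + |S| := by
    have e : h * E = -(T - h * E) + (T - S) + S := by ring
    calc |h * E| = |-(T - h * E) + (T - S) + S| := by rw [← e]
      _ ≤ _ := (abs_add_three _ _ _).trans_eq (by rw [abs_neg])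
  rw [abs_mul, abs_of_pos hh0] at htri
  refine le_of_mul_le_mul_left ?_ hh0
  linarith

/-- conditional bound for `g_k`.
Assume the Riemann hypothesis.  For `k ≥ 2` let `g_k` be the multiplicative
function with `g_k(p^j) = 1` for `1 ≤ j ≤ k-1`, `g_k(p^j) = -1` for
`k ≤ j ≤ 2k-1`, `g_k(p^j) = 0` for `j ≥ 2k`, and `g_k(1) = 1`.  Then for every
`ε > 0`, `Σ_{n ≤ x} g_k(n) - x/ζ(k)² ≪_{k,ε} x^{1/(k+1)+ε}`, where
`ζ(k) = Σ_{n ≥ 1} n^{-k}`. -/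
theorem stmt_18
    (hRH : ∀ ρ : ℂ, riemannZeta ρ = 0 → 0 < ρ.re → ρ.re < 1 → ρ.re = 1 / 2)
    (k : ℕ) (hk : 2 ≤ k) (g : ℕ → ℤ)
    (hg1 : g 1 = 1)
    (hmul : ∀ m n : ℕ, Nat.Coprime m n → g (m * n) = g m * g n)
    (hg_lt : ∀ p : ℕ, Nat.Prime p → ∀ j : ℕ, 1 ≤ j → j ≤ k - 1 → g (p ^ j) = 1)
    (hg_mid : ∀ p : ℕ, Nat.Prime p → ∀ j : ℕ, k ≤ j → j ≤ 2 * k - 1 → g (p ^ j) = -1)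
    (hg_ge : ∀ p : ℕ, Nat.Prime p → ∀ j : ℕ, 2 * k ≤ j → g (p ^ j) = 0) :
    ∀ ε : ℝ, 0 < ε → ∃ C : ℝ, ∀ᶠ x : ℝ in atTop,
      |(∑ n ∈ Finset.Icc 1 ⌊x⌋₊, (g n : ℝ)) -
          x / (∑' n : ℕ, ((n : ℝ) ^ k)⁻¹) ^ 2| ≤
        C * x ^ (1 / ((k : ℝ) + 1) + ε) := by
  intro ε hε
  have hg : IsFakeMoebius k g := ⟨hg1, hmul, hg_lt, hg_mid, hg_ge⟩
  obtain ⟨C, hC⟩ := hg.exists_abs_error_le hRH hk (δ := min (1 / 8) (ε / 2)) (by positivity)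
    ((min_le_left _ _).trans_lt (by norm_num))
  refine ⟨|C|, ?_⟩
  filter_upwards [eventually_ge_atTop 1] with x hx
  refine (hC x hx).trans (mul_le_mul (le_abs_self C) ?_ (by positivity) (abs_nonneg C))
  exact Real.rpow_le_rpow_of_exponent_le hx (by linarith [min_le_right (1 / 8) (ε / 2)])
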